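/- arXiv:1611.06218 — 2 statements merged into one kernel-verified Lean document; each statement's English description precedes it below -/
import Mathlib

section
/- Let f : L_∞(Ω,F,P) → ℝ be a (finite-valued) convex function. Then the following are equivalent: (1) f is continuous for the Mackey topology τ(L_∞,L_1); (2) f is sequentially τ(L_∞,L_1)-continuous; (3) f is continuous for the topology of convergence in probability on norm-bounded subsets of L_∞, i.e. f(ξ_n) → f(ξ) whenever sup_n ‖ξ_n‖_∞ < ∞ and ξ_n → ξ in probability. -/
open MeasureTheory Filter Topology Set
open scoped ENNReal

noncomputable section

namespace OrliczPaper

variable {Ω : Type*} [MeasurableSpace Ω]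

/-- A (finite, coercive) Young function: an even convex function with `Φ 0 = 0`
and `Φ x / x → ∞` as `x → ∞`. -/
structure IsYoung (Φ : ℝ → ℝ) : Prop where
  even : ∀ x, Φ (-x) = Φ x
  convexOn : ConvexOn ℝ Set.univ Φ
  map_zero : Φ 0 = 0
  coercive : Tendsto (fun x => Φ x / x) atTop atTop

/-- The Δ₂-condition: `limsup_{x→∞} Φ(2x)/Φ(x) < ∞`, i.e. `Φ(2x) ≤ C Φ(x)`
for all large `x`. -/
def Delta2 (Φ : ℝ → ℝ) : Prop :=
  ∃ C x₀ : ℝ, ∀ x ≥ x₀, Φ (2 * x) ≤ C * Φ x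

/-- The conjugate Young function `Φ*(y) = sup_x (x y − Φ x)`. -/
def conj (Φ : ℝ → ℝ) (y : ℝ) : ℝ := ⨆ x : ℝ, x * y - Φ x

variable (P : Measure Ω)

/-- Membership in the Orlicz space `L_Φ`: a measurable function with
`E[Φ(l ξ)] < ∞` for some `l > 0`. -/
def MemOrlicz (Φ : ℝ → ℝ) (f : Ω → ℝ) : Prop :=
  Measurable f ∧ ∃ l : ℝ, 0 < l ∧ ∫⁻ ω, ENNReal.ofReal (Φ (l * f ω)) ∂P < ⊤

/-- The Orlicz space `L_Φ`, as a set of (everywhere defined) measurable functions. -/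
def Orlicz (Φ : ℝ → ℝ) : Set (Ω → ℝ) := {f | MemOrlicz P Φ f}

/-- The Luxemburg norm `‖f‖_Φ = inf {l > 0 : E[Φ(f/l)] ≤ 1}`. -/
def luxNorm (Φ : ℝ → ℝ) (f : Ω → ℝ) : ℝ :=
  sInf {l : ℝ | 0 < l ∧ ∫⁻ ω, ENNReal.ofReal (Φ (f ω / l)) ∂P ≤ 1}

/-- The Orlicz (dual) norm `‖f‖_{(Φ*)} = sup {E[g f] : E[Φ(g)] ≤ 1}`
(the Young function `Φ` here is the one of the *predual*). -/
def orliczNorm (Φ : ℝ → ℝ) (f : Ω → ℝ) : ℝ :=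
  sSup {r : ℝ | ∃ g : Ω → ℝ, Measurable g ∧
    (∫⁻ ω, ENNReal.ofReal (Φ (g ω)) ∂P) ≤ 1 ∧ r = ∫ ω, g ω * f ω ∂P}

/-- The bilinear pairing `⟨f, g⟩ = E[f g]`. -/
def pairing (f g : Ω → ℝ) : ℝ := ∫ ω, f ω * g ω ∂P

/-- The weak topology `σ(E, F)` on `E` induced by the pairing with `F`. -/
def weakT (E F : Set (Ω → ℝ)) : TopologicalSpace E :=
  TopologicalSpace.induced
    (fun ξ : E => fun η : F => pairing P (ξ : Ω → ℝ) (η : Ω → ℝ)) inferInstance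

/-- The absolutely convex (convex and balanced) `σ(F,E)`-compact subsets of `F`. -/
def dualSets (E F : Set (Ω → ℝ)) : Set (Set F) :=
  {A | Convex ℝ (Subtype.val '' A) ∧ Balanced ℝ (Subtype.val '' A) ∧
    @IsCompact _ (weakT P F E) A}

/-- The Mackey topology `τ(E, F)`: the topology on `E` of uniform convergence on
absolutely convex `σ(F,E)`-compact subsets of `F`. -/
def mackeyT (E F : Set (Ω → ℝ)) : TopologicalSpace E :=
  TopologicalSpace.induced
    (fun ξ : E => UniformOnFun.ofFun (dualSets P E F)
      (fun η : F => pairing P (ξ : Ω → ℝ) (η : Ω → ℝ)))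
    inferInstance

/-- A distance generating the topology of convergence in `P`-probability. -/
def probDist (f g : Ω → ℝ) : ℝ := ∫ ω, min |f ω - g ω| 1 ∂P

/-- The topology of convergence in probability, restricted to `E ⊆ L₀`. -/
def probT (E : Set (Ω → ℝ)) : TopologicalSpace E :=
  TopologicalSpace.generateFrom
    {U | ∃ f : E, ∃ ε : ℝ, 0 < ε ∧ U = {g : E | probDist P (f : Ω → ℝ) (g : Ω → ℝ) < ε}}

/-- `L_∞`: essentially bounded measurable functions. -/
def Linf : Set (Ω → ℝ) := {f | Measurable f ∧ ∃ C : ℝ, ∀ᵐ ω ∂P, |f ω| ≤ C}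

/-- `L_1`: integrable measurable functions. -/
def L1 : Set (Ω → ℝ) := {f | Measurable f ∧ Integrable f P}

/-- The essential supremum norm. -/
def linfNorm (f : Ω → ℝ) : ℝ := sInf {C : ℝ | 0 ≤ C ∧ ∀ᵐ ω ∂P, |f ω| ≤ C}

/-- Uniform integrability of a set of functions:
`sup_{f ∈ A} E[|f| 1_{|f| > N}] → 0`. -/
def UnifInt (A : Set (Ω → ℝ)) : Prop :=
  Tendsto (fun N : ℕ => ⨆ f ∈ A, ∫⁻ ω in {ω | (N : ℝ) < |f ω|}, ENNReal.ofReal |f ω| ∂P)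
    atTop (𝓝 0)

/-- Uniform integrability of a sequence of functions. -/
def UnifIntSeq (g : ℕ → Ω → ℝ) : Prop :=
  Tendsto (fun N : ℕ => ⨆ n, ∫⁻ ω in {ω | (N : ℝ) < |g n ω|}, ENNReal.ofReal |g n ω| ∂P)
    atTop (𝓝 0)

/-- The Cesàro means of a sequence of functions: `cesaro ξ N` is the average of
`ξ 0, …, ξ N`. -/
def cesaro (ξ : ℕ → Ω → ℝ) (N : ℕ) : Ω → ℝ :=
  fun ω => (∑ i ∈ Finset.range (N + 1), ξ i ω) / (N + 1)

/-- `sup_n |ξ n| ∈ L_Φ` (order boundedness of the sequence `ξ` in `L_Φ`). -/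
def supMem (Φ : ℝ → ℝ) (ξ : ℕ → Ω → ℝ) : Prop :=
  (∀ᵐ ω ∂P, BddAbove (Set.range fun n => |ξ n ω|)) ∧
    MemOrlicz P Φ (fun ω => ⨆ n, |ξ n ω|)

/-- `ξb` is a sequence of forward convex combinations of `ξ`:
`ξb n ∈ conv (ξ k ; k ≥ n)`. -/
def FwdConvComb (ξ ξb : ℕ → Ω → ℝ) : Prop :=
  ∀ n, ξb n ∈ convexHull ℝ {g : Ω → ℝ | ∃ k ≥ n, g = ξ k}

/-- The left derivative of a convex function. -/
def leftDeriv (Φ : ℝ → ℝ) (y : ℝ) : ℝ :=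
  ⨆ h : {h : ℝ // 0 < h}, (Φ y - Φ (y - (h : ℝ))) / (h : ℝ)

/-- `p_Φ(x) = sup_{y > x} y Φ'(y) / Φ(y)`. -/
def pPhiAt (Φ : ℝ → ℝ) (x : ℝ) : ℝ≥0∞ :=
  ⨆ y : {y : ℝ // x < y}, ENNReal.ofReal ((y : ℝ) * leftDeriv Φ (y : ℝ) / Φ (y : ℝ))

/-- `p_Φ = inf_{x ≥ 0} p_Φ(x)`. -/
def pPhi (Φ : ℝ → ℝ) : ℝ≥0∞ := ⨅ x : {x : ℝ // 0 ≤ x}, pPhiAt Φ x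

/-- `q_Φ = p_Φ / (p_Φ − 1)` (with `1/0 = ∞`). -/
def qPhi (Φ : ℝ → ℝ) : ℝ≥0∞ := pPhi Φ / (pPhi Φ - 1)

end OrliczPaper

namespace OrliczPaper

section

variable {Ω : Type*} [MeasurableSpace Ω] {P : Measure Ω}

lemma tendsto_weakT_iff {E F : Set (Ω → ℝ)} {ι : Type*} {l : Filter ι} {u : ι → E} {η : E} :
    Tendsto u l (@nhds _ (weakT P E F) η) ↔
      ∀ ξ : F, Tendsto (fun i => pairing P (u i).1 ξ.1) l (𝓝 (pairing P η.1 ξ.1)) := by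
  rw [weakT, nhds_induced, tendsto_comap_iff, tendsto_pi_nhds]
  rfl

lemma tendsto_mackeyT_iff {E F : Set (Ω → ℝ)} {ι : Type*} {l : Filter ι} {u : ι → E} {ξ : E} :
    Tendsto u l (@nhds _ (mackeyT P E F) ξ) ↔
      ∀ A ∈ dualSets P E F, ∀ ε > 0, ∀ᶠ i in l, ∀ η ∈ A,
        |pairing P ξ.1 η.1 - pairing P (u i).1 η.1| < ε := by
  rw [mackeyT, nhds_induced, tendsto_comap_iff, UniformOnFun.tendsto_iff_tendstoUniformlyOn]
  simp only [Metric.tendstoUniformlyOn_iff, Real.dist_eq]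
  rfl

lemma integrable_mul_of_ae_bound {ξ η : Ω → ℝ} {M : ℝ} (hξ : AEStronglyMeasurable ξ P)
    (hM : ∀ᵐ ω ∂P, |ξ ω| ≤ M) (hη : Integrable η P) : Integrable (fun ω => ξ ω * η ω) P :=
  hη.bdd_mul hξ hM

lemma Linf_integrable_mul {ξ η : Ω → ℝ} (hξ : ξ ∈ Linf P) (hη : Integrable η P) :
    Integrable (fun ω => ξ ω * η ω) P :=
  let ⟨_, hC⟩ := hξ.2
  integrable_mul_of_ae_bound hξ.1.aestronglyMeasurable hC hη

lemma pairing_comm (ξ η : Ω → ℝ) : pairing P ξ η = pairing P η ξ := by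
  simp only [pairing, mul_comm]

lemma Linf_add {ξ ζ : Ω → ℝ} (hξ : ξ ∈ Linf P) (hζ : ζ ∈ Linf P) : ξ + ζ ∈ Linf P := by
  obtain ⟨hm, C, hC⟩ := hξ
  obtain ⟨hm', C', hC'⟩ := hζ
  refine ⟨hm.add hm', C + C', ?_⟩
  filter_upwards [hC, hC'] with ω h h'
  exact (abs_add_le _ _).trans (add_le_add h h')

lemma Linf_smul {ξ : Ω → ℝ} (c : ℝ) (hξ : ξ ∈ Linf P) : c • ξ ∈ Linf P := by
  obtain ⟨hm, C, hC⟩ := hξ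
  refine ⟨hm.const_smul c, |c| * C, ?_⟩
  filter_upwards [hC] with ω h
  simpa [abs_mul] using mul_le_mul_of_nonneg_left h (abs_nonneg c)

lemma Linf_sub {ξ ζ : Ω → ℝ} (hξ : ξ ∈ Linf P) (hζ : ζ ∈ Linf P) : ξ - ζ ∈ Linf P := by
  have := Linf_add hξ (Linf_smul (-1) hζ)
  simpa [sub_eq_add_neg] using this

lemma pairing_add_left {ξ ζ η : Ω → ℝ} (hξ : ξ ∈ Linf P) (hζ : ζ ∈ Linf P) (hη : Integrable η P) :
    pairing P (ξ + ζ) η = pairing P ξ η + pairing P ζ η := by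
  simp only [pairing, Pi.add_apply, add_mul]
  exact integral_add (Linf_integrable_mul hξ hη) (Linf_integrable_mul hζ hη)

lemma pairing_smul_left (c : ℝ) (ξ η : Ω → ℝ) :
    pairing P (c • ξ) η = c * pairing P ξ η := by
  simp only [pairing, Pi.smul_apply, smul_eq_mul, mul_assoc]
  exact integral_const_mul _ _

lemma pairing_sub_left {ξ ζ η : Ω → ℝ} (hξ : ξ ∈ Linf P) (hζ : ζ ∈ Linf P) (hη : Integrable η P) :
    pairing P (ξ - ζ) η = pairing P ξ η - pairing P ζ η := by
  simp only [pairing, Pi.sub_apply, sub_mul]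
  exact integral_sub (Linf_integrable_mul hξ hη) (Linf_integrable_mul hζ hη)

/-- Bounded convergence in probability implies weak* convergence. -/
lemma tendsto_pairing_of_tendstoInMeasure {ξ : ℕ → Ω → ℝ} {ξ₀ η : Ω → ℝ} {M : ℝ}
    (hξ : ∀ n, AEStronglyMeasurable (ξ n) P) (hM : ∀ n, ∀ᵐ ω ∂P, |ξ n ω| ≤ M)
    (h : TendstoInMeasure P ξ atTop ξ₀) (hη : Integrable η P) :
    Tendsto (fun n => pairing P (ξ n) η) atTop (𝓝 (pairing P ξ₀ η)) := by
  refine tendsto_of_subseq_tendsto fun ns hns => ?_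
  obtain ⟨ms, -, hms⟩ := (h.comp hns).exists_seq_tendsto_ae
  refine ⟨ms, tendsto_integral_of_dominated_convergence (fun ω => M * |η ω|)
    (fun n => (hξ _).mul hη.1) (hη.abs.const_mul M) (fun n => ?_) ?_⟩
  · filter_upwards [hM (ns (ms n))] with ω hω
    rw [Real.norm_eq_abs, abs_mul]
    exact mul_le_mul_of_nonneg_right hω (abs_nonneg _)
  · filter_upwards [hms] with ω hω
    exact hω.mul_const _

/-- For a weakly compact `A ⊆ L₁`, a sequence of `[0,1]`-valued functions which tends to zero in
probability cannot pair with elements of `A` to values bounded away from zero. -/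
lemma exists_abs_pairing_lt_of_isCompact [IsProbabilityMeasure P] {A : Set (L1 P)}
    (hA : @IsCompact _ (weakT P (L1 P) (Linf P)) A) {ξ : ℕ → Ω → ℝ} (hξ : ∀ n, Measurable (ξ n))
    (h0 : ∀ n ω, 0 ≤ ξ n ω) (h1 : ∀ n ω, ξ n ω ≤ 1) (h : TendstoInMeasure P ξ atTop 0)
    {η : ℕ → L1 P} (hη : ∀ n, η n ∈ A) {ε : ℝ} (hε : 0 < ε) :
    ∃ n, |pairing P (ξ n) (η n).1| < ε := by
  by_contra! hcon
  let Ψ : Ω → ℕ → ℝ := fun ω n => ξ n ω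
  have hΨm : Measurable Ψ := measurable_pi_lambda _ hξ
  let ν := P.map Ψ
  have hΨ : MeasurePreserving Ψ P ν := ⟨hΨm, rfl⟩
  have : IsProbabilityMeasure ν := Measure.isProbabilityMeasure_map hΨm.aemeasurable
  let J : Lp ℝ 1 ν →+ Lp ℝ 1 P := Lp.compMeasurePreserving Ψ hΨ
  have hJcont : Continuous J := (Lp.isometry_compMeasurePreserving hΨ).continuous
  let B : Set (Lp ℝ 1 ν) := Set.Icc 0 (Lp.const 1 ν (1 : ℝ))
  have hBcl : IsClosed B := isClosed_Icc
  have hJmeas (g : Lp ℝ 1 ν) : Measurable (J g) := (Lp.stronglyMeasurable _).measurable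
  have hJbdd {g : Lp ℝ 1 ν} (hg : g ∈ B) : ∀ᵐ ω ∂P, |J g ω| ≤ 1 := by
    have a0 : ∀ᵐ x ∂ν, 0 ≤ g x := (Lp.coeFn_nonneg g).2 hg.1
    have a1 : ∀ᵐ x ∂ν, g x ≤ 1 := by
      filter_upwards [(Lp.coeFn_le _ _).2 hg.2, Lp.coeFn_const (p := 1) (μ := ν) (1 : ℝ)] with x hx hx'
      simpa [hx'] using hx
    filter_upwards [Lp.coeFn_compMeasurePreserving g hΨ, hΨ.quasiMeasurePreserving.ae a0,
      hΨ.quasiMeasurePreserving.ae a1] with ω e e0 e1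
    change |Lp.compMeasurePreserving Ψ hΨ g ω| ≤ 1
    rw [e]
    exact abs_le.2 ⟨by simp only [Function.comp]; linarith, e1⟩
  have hJmem {g : Lp ℝ 1 ν} (hg : g ∈ B) : (J g : Ω → ℝ) ∈ Linf P := ⟨hJmeas g, 1, hJbdd hg⟩
  have hcont (θ : L1 P) : Continuous fun g : B => pairing P (J g.1) θ.1 := by
    refine continuous_iff_seqContinuous.2 fun u g hu => ?_
    refine tendsto_pairing_of_tendstoInMeasure (M := 1)
      (fun n => (Lp.aestronglyMeasurable _)) (fun n => hJbdd (u n).2) ?_ θ.2.2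
    exact tendstoInMeasure_of_tendsto_Lp
      ((hJcont.tendsto _).comp ((continuous_subtype_val.tendsto _).comp hu))
  have hclip (n : ℕ) : MemLp (fun x : ℕ → ℝ => max 0 (min 1 (x n))) 1 ν := by
    refine MemLp.of_bound (Measurable.aestronglyMeasurable (by fun_prop)) 1 (ae_of_all _ fun x => ?_)
    rw [Real.norm_eq_abs, abs_of_nonneg (le_max_left _ _)]
    exact max_le zero_le_one (min_le_left _ _)
  let w : ℕ → Lp ℝ 1 ν := fun n => (hclip n).toLp _
  have hwB (n : ℕ) : w n ∈ B := by
    refine ⟨(Lp.coeFn_nonneg _).1 ?_, (Lp.coeFn_le _ _).1 ?_⟩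
    · filter_upwards [(hclip n).coeFn_toLp] with x hx
      rw [hx]
      exact le_max_left _ _
    · filter_upwards [(hclip n).coeFn_toLp, Lp.coeFn_const (p := 1) (μ := ν) (1 : ℝ)] with x hx hx'
      rw [hx, hx']
      exact max_le zero_le_one (min_le_left _ _)
  have hJw (n : ℕ) : J (w n) =ᵐ[P] ξ n := by
    filter_upwards [Lp.coeFn_compMeasurePreserving (w n) hΨ,
      hΨ.quasiMeasurePreserving.ae (hclip n).coeFn_toLp] with ω e e'
    change Lp.compMeasurePreserving Ψ hΨ (w n) ω = _
    rw [e]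
    simp only [Function.comp, w, e', Ψ]
    rw [min_eq_right (h1 n ω), max_eq_right (h0 n ω)]
  have hpair (n : ℕ) (θ : Ω → ℝ) : pairing P (J (w n)) θ = pairing P (ξ n) θ :=
    integral_congr_ae ((hJw n).mul (ae_eq_refl θ))
  have hξlim (θ : L1 P) : Tendsto (fun n => pairing P (ξ n) θ.1) atTop (𝓝 0) := by
    have := tendsto_pairing_of_tendstoInMeasure (M := 1) (fun n => (hξ n).aestronglyMeasurable)
      (fun n => ae_of_all _ fun ω => abs_le.2 ⟨by linarith [h0 n ω], h1 n ω⟩) h θ.2.2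
    simpa [pairing] using this
  have hwnorm : Tendsto (fun n => ‖w n‖) atTop (𝓝 0) := by
    have := hξlim ⟨fun _ => 1, measurable_const, integrable_const _⟩
    refine this.congr fun n => ?_
    rw [← Lp.norm_compMeasurePreserving (w n) hΨ, L1.norm_eq_integral_norm]
    refine integral_congr_ae ?_
    filter_upwards [hJw n] with ω e
    change _ = ‖J (w n) ω‖
    rw [e, Real.norm_eq_abs, abs_of_nonneg (h0 n ω), mul_one]
  have : Nonempty B := ⟨⟨w 0, hwB 0⟩⟩
  have : CompleteSpace B := hBcl.completeSpace_coe
  have : Fact ((1 : ℝ≥0∞) ≠ ∞) := ⟨ENNReal.one_ne_top⟩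
  have : SecondCountableTopology (Lp ℝ 1 ν) := inferInstance
  let c : ℕ → B := TopologicalSpace.denseSeq B
  -- a subsequence of `η` along which the pairings with a dense sequence converge
  obtain ⟨θ, hθA, φ, hφ, hlim⟩ : ∃ θ ∈ A, ∃ φ : ℕ → ℕ, StrictMono φ ∧
      ∀ m, Tendsto (fun k => pairing P (J (c m).1) (η (φ k)).1) atTop
        (𝓝 (pairing P (J (c m).1) θ.1)) := by
    have hT : @Continuous _ _ (weakT P (L1 P) (Linf P)) _
        (fun (θ : L1 P) (m : ℕ) => pairing P (J (c m).1) θ.1) := by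
      let _ := weakT P (L1 P) (Linf P)
      refine continuous_pi fun m => continuous_iff_continuousAt.2 fun θ => ?_
      have := tendsto_weakT_iff.1 (@tendsto_id _ (@nhds _ (weakT P (L1 P) (Linf P)) θ))
        ⟨_, hJmem (c m).2⟩
      simp only [pairing_comm _ (J (c m).1), id] at this
      exact this
    have hK := @IsCompact.image _ _ (weakT P (L1 P) (Linf P)) _ _ _ hA hT
    obtain ⟨y, ⟨θ, hθ, rfl⟩, φ, hφ, hy⟩ := hK.tendsto_subseq fun n => mem_image_of_mem _ (hη n)
    exact ⟨θ, hθ, φ, hφ, fun m => tendsto_pi_nhds.1 hy m⟩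
  have hlim' (g : B) : Tendsto (fun k => pairing P (J g.1) (η (φ k)).1) atTop
      (𝓝 (pairing P (J g.1) θ.1)) := by
    rw [tendsto_iff_ultrafilter]
    intro U hU
    obtain ⟨θ', -, hθ'⟩ := @IsCompact.ultrafilter_le_nhds _ (weakT P (L1 P) (Linf P)) _ hA
      (U.map fun k => η (φ k)) (by
        rw [le_principal_iff, Ultrafilter.mem_coe, Ultrafilter.mem_map]
        exact Filter.univ_mem' fun k => hη _)
    have hg' (g : B) : Tendsto (fun k => pairing P (J g.1) (η (φ k)).1) U
        (𝓝 (pairing P (J g.1) θ'.1)) := by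
      have := tendsto_weakT_iff.1 (show Tendsto (fun k => η (φ k)) U _ from hθ') ⟨_, hJmem g.2⟩
      simpa only [pairing_comm _ (J g.1)] using this
    have heq : (fun g : B => pairing P (J g.1) θ'.1) = fun g : B => pairing P (J g.1) θ.1 := by
      refine (hcont θ').ext_on (TopologicalSpace.denseRange_denseSeq B) (hcont θ) ?_
      rintro _ ⟨m, rfl⟩
      exact tendsto_nhds_unique (hg' (c m)) ((hlim m).mono_left hU)
    rw [← congrFun heq g]
    exact hg' g
  let F : ℕ → Set B := fun N =>
    {g | ∀ k ≥ N, |pairing P (J g.1) (η (φ k)).1 - pairing P (J g.1) θ.1| ≤ ε / 4}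
  have hFcl (N : ℕ) : IsClosed (F N) := by
    simp only [F, Set.ofPred_forall]
    exact isClosed_iInter fun k => isClosed_iInter fun _ =>
      isClosed_le ((hcont _).sub (hcont _)).abs continuous_const
  have hFun : ⋃ N, F N = univ := by
    refine eq_univ_of_forall fun g => mem_iUnion.2 ?_
    obtain ⟨N, hN⟩ := Metric.tendsto_atTop.1 (hlim' g) (ε / 4) (by positivity)
    exact ⟨N, fun k hk => (hN k hk).le⟩
  obtain ⟨N, g₀, hg₀⟩ := nonempty_interior_of_iUnion_of_closed hFcl hFun
  obtain ⟨r, hr, hball⟩ := Metric.mem_nhds_iff.1 (mem_interior_iff_mem_nhds.1 hg₀)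
  have hmem {g : Lp ℝ 1 ν} (hg : g ∈ B) (hd : ‖g - g₀.1‖ < r) : (⟨g, hg⟩ : B) ∈ F N :=
    hball (by rw [Metric.mem_ball, Subtype.dist_eq, dist_eq_norm]; exact hd)
  have hsmall (n : ℕ) (hn : ‖w n‖ < r / 2) (k : ℕ) (hk : N ≤ k) :
      |pairing P (J (w n)) (η (φ k)).1 - pairing P (J (w n)) θ.1| ≤ ε / 2 := by
    let u := w n ⊔ g₀.1
    have hu : u ∈ B := ⟨(hwB n).1.trans le_sup_left, sup_le (hwB n).2 g₀.2.2⟩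
    have hv : u - w n ∈ B := by
      refine ⟨sub_nonneg.2 le_sup_left, ?_⟩
      rw [sub_le_iff_le_add]
      exact sup_le (le_add_of_nonneg_left ((hwB n).1.trans (hwB n).2))
        (g₀.2.2.trans (le_add_of_nonneg_right (hwB n).1))
    have hun : ‖u - g₀.1‖ ≤ ‖w n‖ := by
      have := norm_sup_sub_sup_le_norm (w n) 0 g₀.1
      rwa [sup_eq_right.2 g₀.2.1, sub_zero] at this
    have hvn : ‖u - w n - g₀.1‖ < r := by
      calc ‖u - w n - g₀.1‖ = ‖(u - g₀.1) - w n‖ := by congr 1; abel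
        _ ≤ ‖u - g₀.1‖ + ‖w n‖ := norm_sub_le _ _
        _ < r := by linarith
    have e1 := hmem hu (by linarith) k hk
    have e2 := hmem hv hvn k hk
    have hsub (ζ : L1 P) : pairing P (J (w n)) ζ.1
        = pairing P (J u) ζ.1 - pairing P (J (u - w n)) ζ.1 := by
      rw [← pairing_sub_left (hJmem hu) (hJmem hv) ζ.2.2]
      refine integral_congr_ae ?_
      filter_upwards [Lp.coeFn_sub (J u) (J (w n))] with ω e
      simp only [map_sub, Pi.sub_apply] at e ⊢
      rw [e]
      ring
    rw [hsub, hsub]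
    rw [abs_le] at *
    constructor <;> linarith [e1.1, e1.2, e2.1, e2.2]
  have ev1 : ∀ᶠ k in atTop, ‖w (φ k)‖ < r / 2 :=
    (hwnorm.comp hφ.tendsto_atTop).eventually_lt_const (by positivity)
  have ev2 : ∀ᶠ k in atTop, |pairing P (ξ (φ k)) θ.1| < ε / 2 := by
    have := ((hξlim θ).comp hφ.tendsto_atTop).abs
    rw [abs_zero] at this
    exact this.eventually_lt_const (by positivity)
  obtain ⟨k, hk1, hk2, hk3⟩ := (ev1.and (ev2.and (eventually_ge_atTop N))).exists
  have a := hsmall _ hk1 k hk3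
  have b := hcon (φ k)
  rw [hpair, hpair] at a
  have := abs_sub_abs_le_abs_sub (pairing P (ξ (φ k)) (η (φ k)).1) (pairing P (ξ (φ k)) θ.1)
  linarith

lemma tendstoInMeasure_zero_of_abs_le {ξ ζ : ℕ → Ω → ℝ} (h : TendstoInMeasure P ξ atTop 0)
    (hle : ∀ n ω, |ζ n ω| ≤ |ξ n ω|) : TendstoInMeasure P ζ atTop 0 := by
  rw [tendstoInMeasure_iff_norm] at h ⊢
  refine fun ε hε => tendsto_of_tendsto_of_tendsto_of_le_of_le tendsto_const_nhds (h ε hε)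
    (fun _ => zero_le) fun n => measure_mono fun ω hω => ?_
  simp only [Pi.zero_apply, sub_zero, Real.norm_eq_abs] at hω ⊢
  exact le_trans hω (hle n ω)

/-- Norm-bounded sequences in `L_∞` which tend to zero in probability tend to zero uniformly on
weakly compact subsets of `L₁`. -/
lemma eventually_abs_pairing_lt_of_isCompact [IsProbabilityMeasure P] {A : Set (L1 P)}
    (hA : @IsCompact _ (weakT P (L1 P) (Linf P)) A) {ξ : ℕ → Ω → ℝ} (hξ : ∀ n, Measurable (ξ n))
    {M : ℝ} (hM : ∀ n, ∀ᵐ ω ∂P, |ξ n ω| ≤ M) (h : TendstoInMeasure P ξ atTop 0)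
    {ε : ℝ} (hε : 0 < ε) :
    ∀ᶠ n in atTop, ∀ η ∈ A, |pairing P (ξ n) η.1| < ε := by
  have unit {ζ : ℕ → Ω → ℝ} (hζ : ∀ n, Measurable (ζ n)) (h0 : ∀ n ω, 0 ≤ ζ n ω)
      (h1 : ∀ n ω, ζ n ω ≤ 1) (h : TendstoInMeasure P ζ atTop 0) {δ : ℝ} (hδ : 0 < δ) :
      ∀ᶠ n in atTop, ∀ η ∈ A, |pairing P (ζ n) η.1| < δ := by
    by_contra hcon
    simp only [not_eventually] at hcon
    obtain ⟨φ, hφ, hcon⟩ := extraction_of_frequently_atTop hcon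
    push Not at hcon
    choose η hη hle using hcon
    obtain ⟨n, hn⟩ := exists_abs_pairing_lt_of_isCompact hA (fun n => hζ (φ n)) (fun n => h0 (φ n))
      (fun n => h1 (φ n)) (h.comp hφ.tendsto_atTop) hη hδ
    exact (hle n).not_gt hn
  let K : ℝ := max M 1
  have hK : 1 ≤ K := le_max_right _ _
  have hK0 : 0 < K := by linarith
  let ζ : ℝ → ℕ → Ω → ℝ := fun s n ω => max 0 (min 1 (s * ξ n ω / K))
  have hζm (s : ℝ) (n : ℕ) : Measurable (ζ s n) := by
    have := hξ n
    fun_prop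
  have hζ0 (s : ℝ) (n : ℕ) (ω : Ω) : 0 ≤ ζ s n ω := le_max_left _ _
  have hζ1 (s : ℝ) (n : ℕ) (ω : Ω) : ζ s n ω ≤ 1 := max_le zero_le_one (min_le_left _ _)
  have hζle {s : ℝ} (hs : |s| = 1) (n : ℕ) (ω : Ω) : |ζ s n ω| ≤ |ξ n ω| := by
    rw [abs_of_nonneg (hζ0 _ _ _)]
    refine max_le (abs_nonneg _) ((min_le_right _ _).trans ((le_abs_self _).trans ?_))
    rw [abs_div, abs_mul, hs, one_mul, abs_of_pos hK0]
    exact div_le_self (abs_nonneg _) hK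
  have hζmem (s : ℝ) (n : ℕ) : ζ s n ∈ Linf P :=
    ⟨hζm s n, 1, ae_of_all _ fun ω => by rw [abs_of_nonneg (hζ0 _ _ _)]; exact hζ1 _ _ _⟩
  have ev {s : ℝ} (hs : |s| = 1) := unit (hζm s) (hζ0 s) (hζ1 s)
    (tendstoInMeasure_zero_of_abs_le h (hζle hs)) (δ := ε / (2 * K)) (by positivity)
  filter_upwards [ev (s := 1) (by simp), ev (s := -1) (by simp)] with n h1 h2 η hη
  have heq : pairing P (ξ n) η.1 = K * (pairing P (ζ 1 n) η.1 - pairing P (ζ (-1) n) η.1) := by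
    rw [← pairing_sub_left (hζmem _ _) (hζmem _ _) η.2.2, ← pairing_smul_left]
    refine integral_congr_ae ?_
    filter_upwards [hM n] with ω hω
    have hω' : |ξ n ω / K| ≤ 1 := by
      rw [abs_div, abs_of_pos hK0]
      exact (div_le_one hK0).2 (hω.trans (le_max_left _ _))
    have key : ∀ x : ℝ, |x| ≤ 1 → x = max 0 (min 1 x) - max 0 (min 1 (-x)) := by
      intro x hx
      obtain ⟨ha, hb⟩ := abs_le.1 hx
      rw [min_eq_right hb, min_eq_right (by linarith : -x ≤ 1)]
      rcases le_total 0 x with h | h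
      · rw [max_eq_right h, max_eq_left (by linarith)]; ring
      · rw [max_eq_left h, max_eq_right (by linarith)]; ring
    have := key _ hω'
    simp only [ζ, Pi.smul_apply, Pi.sub_apply, smul_eq_mul, one_mul, neg_mul, neg_div]
    rw [← this, mul_div_cancel₀ _ hK0.ne']
  rw [heq, abs_mul, abs_of_pos hK0]
  calc K * |pairing P (ζ 1 n) η.1 - pairing P (ζ (-1) n) η.1|
      ≤ K * (|pairing P (ζ 1 n) η.1| + |pairing P (ζ (-1) n) η.1|) := by gcongr; exact abs_sub _ _
    _ < K * (ε / (2 * K) + ε / (2 * K)) := by gcongr; exacts [h1 η hη, h2 η hη]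
    _ = ε := by field_simp; ring

lemma ae_abs_le_of_linfNorm_lt {ξ : Ω → ℝ} (hξ : ξ ∈ Linf P) {M : ℝ} (h : linfNorm P ξ < M) :
    ∀ᵐ ω ∂P, |ξ ω| ≤ M := by
  obtain ⟨-, C, hC⟩ := hξ
  obtain ⟨D, hD, hDM⟩ := exists_lt_of_csInf_lt
    (s := {C : ℝ | 0 ≤ C ∧ ∀ᵐ ω ∂P, |ξ ω| ≤ C})
    ⟨max C 0, le_max_right _ _, hC.mono fun ω hω => hω.trans (le_max_left _ _)⟩ h
  exact hD.2.mono fun ω hω => hω.trans hDM.le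

lemma linfNorm_le {ξ : Ω → ℝ} {M : ℝ} (hM : 0 ≤ M) (h : ∀ᵐ ω ∂P, |ξ ω| ≤ M) :
    linfNorm P ξ ≤ M :=
  csInf_le ⟨0, fun _ hC => hC.1⟩ ⟨hM, h⟩

/-- Norm-bounded convergence in probability implies convergence in the Mackey topology. -/
lemma tendsto_mackeyT_of_tendstoInMeasure [IsProbabilityMeasure P] {ξ : ℕ → Linf P} {ξ₀ : Linf P}
    {M : ℝ} (hM : ∀ n, linfNorm P (ξ n).1 ≤ M)
    (h : TendstoInMeasure P (fun n => (ξ n).1) atTop ξ₀.1) :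
    Tendsto ξ atTop (@nhds _ (mackeyT P (Linf P) (L1 P)) ξ₀) := by
  refine tendsto_mackeyT_iff.2 fun A hA ε hε => ?_
  obtain ⟨C, hC⟩ := ξ₀.2.2
  have := eventually_abs_pairing_lt_of_isCompact hA.2.2 (ξ := fun n => (ξ n).1 - ξ₀.1)
    (fun n => (Linf_sub (ξ n).2 ξ₀.2).1) (M := M + 1 + C) (fun n => ?_) ?_ hε
  · filter_upwards [this] with n hn η hη
    rw [abs_sub_comm, ← pairing_sub_left (ξ n).2 ξ₀.2 η.2.2]
    exact hn η hη
  · filter_upwards [hC, ae_abs_le_of_linfNorm_lt (ξ n).2 ((hM n).trans_lt (lt_add_one M))]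
      with ω h1 h2
    exact (abs_sub _ _).trans (add_le_add h2 h1)
  · rw [tendstoInMeasure_iff_norm] at h ⊢
    simpa using h

lemma indicator_one_mem_Linf {s : Set Ω} (hs : MeasurableSet s) :
    s.indicator (fun _ => (1 : ℝ)) ∈ Linf P :=
  ⟨measurable_const.indicator hs, 1, ae_of_all _ fun ω => by
    by_cases h : ω ∈ s <;> simp [h]⟩

/-- A linear functional on `L_∞` which is dominated by `1 / (k + 1) + N k * ‖·‖₁` on the unit ball,
for each `k`, tends to zero along bounded `L₁`-null families. -/
lemma tendsto_zero_of_dominated {ℓ : (Ω → ℝ) → ℝ} {N : ℕ → ℝ}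
    (hsmul : ∀ (c : ℝ), ∀ ξ ∈ Linf P, ℓ (c • ξ) = c * ℓ ξ)
    (hbd : ∀ k : ℕ, ∀ ξ ∈ Linf P, (∀ᵐ ω ∂P, |ξ ω| ≤ 1) →
      ℓ ξ ≤ 1 / ((k : ℝ) + 1) + N k * ∫ ω, |ξ ω| ∂P)
    {ι : Type*} {l : Filter ι} {ζ : ι → Ω → ℝ} (hζ : ∀ i, ζ i ∈ Linf P) {M : ℝ} (hM : 0 < M)
    (hζM : ∀ i, ∀ᵐ ω ∂P, |ζ i ω| ≤ M) (h : Tendsto (fun i => ∫ ω, |ζ i ω| ∂P) l (𝓝 0)) :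
    Tendsto (fun i => ℓ (ζ i)) l (𝓝 0) := by
  have habs (k : ℕ) (i : ι) : |ℓ (ζ i)| ≤ M / ((k : ℝ) + 1) + N k * ∫ ω, |ζ i ω| ∂P := by
    have key (s : ℝ) (hs : |s| = 1) :
        s * ℓ (ζ i) ≤ M / ((k : ℝ) + 1) + N k * ∫ ω, |ζ i ω| ∂P := by
      have hint : ∫ ω, |((s / M) • ζ i) ω| ∂P = M⁻¹ * ∫ ω, |ζ i ω| ∂P := by
        rw [← integral_const_mul]
        refine integral_congr_ae (ae_of_all _ fun ω => ?_)
        simp [abs_mul, abs_div, hs, abs_of_pos hM]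
      have := hbd k ((s / M) • ζ i) (Linf_smul _ (hζ i)) (by
        filter_upwards [hζM i] with ω hω
        simp only [Pi.smul_apply, smul_eq_mul, abs_mul, abs_div, hs, abs_of_pos hM]
        rw [div_mul_eq_mul_div, one_mul]
        exact (div_le_one hM).2 hω)
      rw [hsmul _ _ (hζ i), hint] at this
      have h2 := mul_le_mul_of_nonneg_left this hM.le
      have e1 : M * (s / M * ℓ (ζ i)) = s * ℓ (ζ i) := by field_simp
      have e2 : M * (1 / ((k : ℝ) + 1) + N k * (M⁻¹ * ∫ ω, |ζ i ω| ∂P))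
          = M / ((k : ℝ) + 1) + N k * ∫ ω, |ζ i ω| ∂P := by field_simp
      linarith
    refine abs_le'.2 ⟨by simpa using key 1 (by simp), by simpa using key (-1) (by simp)⟩
  refine Metric.tendsto_nhds.2 fun ε hε => ?_
  obtain ⟨k, hk⟩ := exists_nat_gt (2 * M / ε)
  have hk' : M / ((k : ℝ) + 1) < ε / 2 := by
    rw [div_lt_iff₀ hε] at hk
    rw [div_lt_div_iff₀ (by positivity) (by positivity)]
    nlinarith
  have h' : Tendsto (fun i => N k * ∫ ω, |ζ i ω| ∂P) l (𝓝 0) := by simpa using h.const_mul (N k)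
  filter_upwards [h'.eventually_lt_const (half_pos hε)] with i hi
  rw [Real.dist_eq, sub_zero]
  linarith [habs k i]

/-- A linear functional on `L_∞` which is dominated by `1 / (k + 1) + N k * ‖·‖₁` on the unit ball,
for each `k`, is represented by an element of `L₁`. -/
lemma exists_pairing_eq_of_dominated [IsProbabilityMeasure P] {ℓ : (Ω → ℝ) → ℝ} {N : ℕ → ℝ}
    (hadd : ∀ ξ ∈ Linf P, ∀ ζ ∈ Linf P, ℓ (ξ + ζ) = ℓ ξ + ℓ ζ)
    (hsmul : ∀ (c : ℝ), ∀ ξ ∈ Linf P, ℓ (c • ξ) = c * ℓ ξ)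
    (hbd : ∀ k : ℕ, ∀ ξ ∈ Linf P, (∀ᵐ ω ∂P, |ξ ω| ≤ 1) →
      ℓ ξ ≤ 1 / ((k : ℝ) + 1) + N k * ∫ ω, |ξ ω| ∂P) :
    ∃ η : L1 P, ∀ ξ ∈ Linf P, ℓ ξ = pairing P ξ η.1 := by
  classical
  let one : Set Ω → Ω → ℝ := fun s => s.indicator fun _ => (1 : ℝ)
  have hone {s : Set Ω} (hs : MeasurableSet s) : one s ∈ Linf P := indicator_one_mem_Linf hs
  have hone_le (s : Set Ω) : ∀ᵐ ω ∂P, |one s ω| ≤ 1 := ae_of_all _ fun ω => by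
    by_cases h : ω ∈ s <;> simp [one, h]
  have hone_int {s : Set Ω} (hs : MeasurableSet s) : ∫ ω, |one s ω| ∂P = P.real s := by
    rw [← integral_indicator_one hs]
    refine integral_congr_ae (ae_of_all _ fun ω => ?_)
    by_cases h : ω ∈ s <;> simp [one, h]
  have hempty : ℓ (one ∅) = 0 := by
    have e : (0 : ℝ) • one ∅ = one ∅ := by ext; simp [one]
    have := hsmul 0 (one ∅) (hone MeasurableSet.empty)
    rwa [e, zero_mul] at this
  have hdisj {s t : Set Ω} (hs : MeasurableSet s) (ht : MeasurableSet t) (hst : Disjoint s t) :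
      ℓ (one (s ∪ t)) = ℓ (one s) + ℓ (one t) := by
    rw [← hadd _ (hone hs) _ (hone ht)]
    congr 1
    exact indicator_union_of_disjoint hst _
  let ν : SignedMeasure Ω :=
    { measureOf' := fun s => if MeasurableSet s then ℓ (one s) else 0
      empty' := by simpa using hempty
      not_measurable' := fun s hs => if_neg hs
      m_iUnion' := by
        intro f hf hd
        have hU : MeasurableSet (⋃ i, f i) := MeasurableSet.iUnion hf
        simp only [hf, hU, if_true]
        have hfin (s : Finset ℕ) : MeasurableSet (⋃ i ∈ s, f i) :=
          Finset.measurableSet_biUnion _ fun i _ => hf i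
        have hsum (s : Finset ℕ) : ∑ i ∈ s, ℓ (one (f i)) = ℓ (one (⋃ i ∈ s, f i)) := by
          induction s using Finset.induction_on with
          | empty => simpa using hempty.symm
          | insert a s ha ih =>
            rw [Finset.sum_insert ha, ih, Finset.set_biUnion_insert, hdisj (hf a) (hfin s)]
            refine disjoint_iUnion₂_right.2 fun i hi => hd ?_
            rintro rfl
            exact ha hi
        have hdiff (s : Finset ℕ) : ∑ i ∈ s, ℓ (one (f i))
            = ℓ (one (⋃ i, f i)) - ℓ (one ((⋃ i, f i) \ ⋃ i ∈ s, f i)) := by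
          have hsub : ⋃ i ∈ s, f i ⊆ ⋃ i, f i := iUnion₂_subset fun i _ => subset_iUnion f i
          have := hdisj (hfin s) (hU.diff (hfin s)) disjoint_sdiff_right
          rw [union_sdiff_cancel hsub] at this
          rw [hsum, this]
          ring
        have hP : Tendsto (fun s : Finset ℕ => P.real ((⋃ i, f i) \ ⋃ i ∈ s, f i)) atTop
            (𝓝 0) := by
          have h1 := P.toSignedMeasure.m_iUnion hf hd
          simp only [Measure.toSignedMeasure_apply_measurable, hf, hU] at h1
          have h2 : Tendsto (fun s : Finset ℕ => P.real (⋃ i, f i) - ∑ i ∈ s, P.real (f i)) atTop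
              (𝓝 (P.real (⋃ i, f i) - P.real (⋃ i, f i))) := tendsto_const_nhds.sub h1
          rw [sub_self] at h2
          refine h2.congr fun s => ?_
          rw [measureReal_sdiff (iUnion₂_subset fun i _ => subset_iUnion f i) (hfin s),
            measureReal_biUnion_finset (fun i _ j _ hij => hd hij) fun i _ => hf i]
        have h0 := tendsto_zero_of_dominated hsmul hbd
          (fun s : Finset ℕ => hone (hU.diff (hfin s))) one_pos (fun s => hone_le _)
          (hP.congr fun s => (hone_int (hU.diff (hfin s))).symm)
        have h1 := (tendsto_const_nhds (x := ℓ (one (⋃ i, f i)))).sub h0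
        rw [sub_zero] at h1
        exact h1.congr fun s => (hdiff s).symm }
  have hν {s : Set Ω} (hs : MeasurableSet s) : ν s = ℓ (one s) := if_pos hs
  have hac : ν ≪ᵥ P.toENNRealVectorMeasure := by
    refine VectorMeasure.AbsolutelyContinuous.mk fun s hs h0 => ?_
    rw [Measure.toENNRealVectorMeasure_apply_measurable hs] at h0
    have : Tendsto (fun _ : ℕ => ∫ ω, |one s ω| ∂P) atTop (𝓝 0) := by
      rw [hone_int hs, measureReal_def, h0]
      exact tendsto_const_nhds
    rw [hν hs]
    exact tendsto_nhds_unique tendsto_const_nhds (tendsto_zero_of_dominated hsmul hbd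
      (fun _ => hone hs) one_pos (fun _ => hone_le s) this)
  have hdens := ν.withDensityᵥ_rnDeriv_eq P hac
  let η : L1 P := ⟨ν.rnDeriv P, ν.measurable_rnDeriv P, ν.integrable_rnDeriv P⟩
  refine ⟨η, ?_⟩
  have hset {s : Set Ω} (hs : MeasurableSet s) : ℓ (one s) = pairing P (one s) η.1 := by
    rw [← hν hs, ← hdens, withDensityᵥ_apply (ν.integrable_rnDeriv P) hs, ← integral_indicator hs]
    refine integral_congr_ae (ae_of_all _ fun ω => ?_)
    by_cases h : ω ∈ s <;> simp [one, h, η]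
  have hsf_mem (g : SimpleFunc Ω ℝ) : (g : Ω → ℝ) ∈ Linf P := by
    obtain ⟨C, hC⟩ := g.exists_forall_norm_le
    exact ⟨g.measurable, C, ae_of_all _ hC⟩
  have hsf (g : SimpleFunc Ω ℝ) : ℓ g = pairing P g η.1 := by
    induction g using SimpleFunc.induction with
    | const c hs =>
      rename_i s
      have : ⇑(SimpleFunc.piecewise s hs (SimpleFunc.const Ω c) (SimpleFunc.const Ω 0))
          = c • one s := by
        ext ω
        by_cases h : ω ∈ s <;> simp [one, h]
      rw [this, hsmul _ _ (hone hs), pairing_smul_left, hset hs]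
    | add _ hf hg =>
      rename_i f g _
      rw [SimpleFunc.coe_add, hadd _ (hsf_mem f) _ (hsf_mem g),
        pairing_add_left (hsf_mem f) (hsf_mem g) η.2.2, hf, hg]
  intro ξ hξ
  obtain ⟨C, hC⟩ := hξ.2
  let g : ℕ → SimpleFunc Ω ℝ := SimpleFunc.approxOn ξ hξ.1 univ 0 trivial
  have hgmem (n : ℕ) : ξ - g n ∈ Linf P := Linf_sub hξ (hsf_mem _)
  have hC' : ∀ᵐ ω ∂P, ∀ n, |(ξ - g n) ω| ≤ 3 * |C| + 1 := by
    filter_upwards [hC] with ω hω n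
    have h1 := SimpleFunc.norm_approxOn_zero_le hξ.1 (s := univ) trivial ω n
    have h2 : |(ξ - g n) ω| ≤ |ξ ω| + |g n ω| := abs_sub _ _
    simp only [Real.norm_eq_abs] at h1
    linarith [le_abs_self C, show |g n ω| ≤ |ξ ω| + |ξ ω| from h1]
  have hlim : TendstoInMeasure P (fun n => ξ - ⇑(g n)) atTop 0 := by
    refine tendstoInMeasure_of_tendsto_ae (fun n => (hgmem n).1.aestronglyMeasurable)
      (ae_of_all _ fun ω => ?_)
    have := SimpleFunc.tendsto_approxOn hξ.1 (s := univ) (y₀ := 0) trivial (x := ω) (by simp)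
    simpa using (tendsto_const_nhds (x := ξ ω)).sub this
  have hint : Tendsto (fun n => ∫ ω, |(ξ - g n) ω| ∂P) atTop (𝓝 0) := by
    have := tendsto_pairing_of_tendstoInMeasure (M := 3 * |C| + 1)
      (ξ := fun n ω => |(ξ - g n) ω|) (ξ₀ := 0)
      (fun n => (hgmem n).1.abs.aestronglyMeasurable)
      (fun n => by filter_upwards [hC'] with ω hω; rw [abs_abs]; exact hω n)
      (tendstoInMeasure_zero_of_abs_le hlim fun n ω => (abs_abs _).le)
      (integrable_const (1 : ℝ))
    simpa [pairing] using this
  have l1 := tendsto_zero_of_dominated hsmul hbd hgmem (M := 3 * |C| + 1) (by positivity)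
    (fun n => hC'.mono fun ω hω => hω n) hint
  have l2 := tendsto_pairing_of_tendstoInMeasure
    (fun n => (hgmem n).1.aestronglyMeasurable)
    (fun n => hC'.mono fun ω hω => hω n) hlim η.2.2
  have l3 : Tendsto (fun _ : ℕ => ℓ ξ - pairing P ξ η.1) atTop (𝓝 (0 - pairing P 0 η.1)) := by
    refine (l1.sub l2).congr fun n => ?_
    have : ℓ (ξ - g n) = ℓ ξ - ℓ (g n) := by
      have := hadd _ (hgmem n) _ (hsf_mem (g n))
      rw [sub_add_cancel] at this
      linarith
    rw [this, hsf, pairing_sub_left hξ (hsf_mem _) η.2.2]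
    ring
  have := tendsto_nhds_unique tendsto_const_nhds l3
  simp only [pairing, Pi.zero_apply, zero_mul, integral_zero, sub_zero] at this
  exact sub_eq_zero.1 this

/-- The functions `η ∈ L₁` whose functional is dominated by `1 / (k + 1) + N k * ‖·‖₁` on the unit
ball of `L_∞`, for each `k`. -/
def uiSet (P : Measure Ω) (N : ℕ → ℝ) : Set (L1 P) :=
  {η | ∀ k : ℕ, ∀ ξ ∈ Linf P, (∀ᵐ ω ∂P, |ξ ω| ≤ 1) →
    pairing P ξ η.1 ≤ 1 / ((k : ℝ) + 1) + N k * ∫ ω, |ξ ω| ∂P}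

lemma convex_uiSet (N : ℕ → ℝ) : Convex ℝ (Subtype.val '' uiSet P N) := by
  rintro _ ⟨η, hη, rfl⟩ _ ⟨η', hη', rfl⟩ a b ha hb hab
  refine ⟨⟨a • η.1 + b • η'.1, (η.2.1.const_smul a).add (η'.2.1.const_smul b),
    (η.2.2.smul a).add (η'.2.2.smul b)⟩, fun k ξ hξ h1 => ?_, rfl⟩
  have e : pairing P ξ (a • η.1 + b • η'.1) = a * pairing P ξ η.1 + b * pairing P ξ η'.1 := by
    simp only [pairing, Pi.add_apply, Pi.smul_apply, smul_eq_mul, ← integral_const_mul]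
    rw [← integral_add ((Linf_integrable_mul hξ η.2.2).const_mul a)
      ((Linf_integrable_mul hξ η'.2.2).const_mul b)]
    refine integral_congr_ae (ae_of_all _ fun ω => ?_)
    ring
  rw [e]
  have h := mul_le_mul_of_nonneg_left (hη k ξ hξ h1) ha
  have h' := mul_le_mul_of_nonneg_left (hη' k ξ hξ h1) hb
  calc _ ≤ _ := add_le_add h h'
    _ = (a + b) * (1 / ((k : ℝ) + 1) + N k * ∫ ω, |ξ ω| ∂P) := by ring
    _ = _ := by rw [hab, one_mul]

lemma balanced_uiSet {N : ℕ → ℝ} (hN : ∀ k, 0 ≤ N k) : Balanced ℝ (Subtype.val '' uiSet P N) := by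
  rintro a ha _ ⟨_, ⟨η, hη, rfl⟩, rfl⟩
  rw [Real.norm_eq_abs] at ha
  refine ⟨⟨a • η.1, η.2.1.const_smul a, η.2.2.smul a⟩, fun k ξ hξ h1 => ?_, rfl⟩
  have e : pairing P ξ (a • η.1) = pairing P (a • ξ) η.1 := by
    rw [pairing_comm, pairing_smul_left, pairing_smul_left, pairing_comm]
  have e' : ∫ ω, |(a • ξ) ω| ∂P = |a| * ∫ ω, |ξ ω| ∂P := by
    simp only [Pi.smul_apply, smul_eq_mul, abs_mul, integral_const_mul]
  have := hη k (a • ξ) (Linf_smul a hξ) (by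
    filter_upwards [h1] with ω hω
    rw [Pi.smul_apply, smul_eq_mul, abs_mul]
    exact mul_le_one₀ ha (abs_nonneg _) hω)
  rw [e'] at this
  have hI : 0 ≤ ∫ ω, |ξ ω| ∂P := integral_nonneg fun _ => abs_nonneg _
  have := mul_le_mul_of_nonneg_left (mul_le_of_le_one_left hI ha) (hN k)
  simp only [e]
  linarith

lemma exists_abs_pairing_le_uiSet (N : ℕ → ℝ) {ξ : Ω → ℝ} (hξ : ξ ∈ Linf P) :
    ∃ B : ℝ, ∀ η ∈ uiSet P N, |pairing P ξ η.1| ≤ B := by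
  obtain ⟨C, hC⟩ := hξ.2
  have hpos : 0 < |C| + 1 := by positivity
  let ζ : ℝ → Ω → ℝ := fun s => (s / (|C| + 1)) • ξ
  let B : ℝ → ℝ := fun s => (|C| + 1) * (1 + |N 0 * ∫ ω, |(ζ s) ω| ∂P|)
  have key (s : ℝ) (hs : |s| = 1) (η : L1 P) (hη : η ∈ uiSet P N) :
      s * pairing P ξ η.1 ≤ B s := by
    have := hη 0 (ζ s) (Linf_smul _ hξ) (by
      filter_upwards [hC] with ω hω
      simp only [ζ, Pi.smul_apply, smul_eq_mul, abs_mul, abs_div, hs, abs_of_pos hpos]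
      rw [div_mul_eq_mul_div, one_mul]
      exact (div_le_one hpos).2 (by linarith [le_abs_self C]))
    rw [pairing_smul_left] at this
    have h2 := mul_le_mul_of_nonneg_left (this.trans (add_le_add_right (le_abs_self _) _)) hpos.le
    have e1 : (|C| + 1) * (s / (|C| + 1) * pairing P ξ η.1) = s * pairing P ξ η.1 := by field_simp
    simpa [e1, B] using h2
  refine ⟨max (B 1) (B (-1)), fun η hη => abs_le'.2 ⟨?_, ?_⟩⟩
  · have := key 1 (by simp) η hη
    rw [one_mul] at this
    exact this.trans (le_max_left _ _)
  · have := key (-1) (by simp) η hη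
    rw [neg_one_mul] at this
    exact this.trans (le_max_right _ _)

lemma isCompact_uiSet [IsProbabilityMeasure P] (N : ℕ → ℝ) :
    @IsCompact _ (weakT P (L1 P) (Linf P)) (uiSet P N) := by
  refine (@isCompact_iff_ultrafilter_le_nhds _ (weakT P (L1 P) (Linf P)) _).2 fun U hU => ?_
  have hmem : ∀ᶠ η in (U : Filter (L1 P)), η ∈ uiSet P N := le_principal_iff.1 hU
  have hex (ξ : Ω → ℝ) : ∃ x : ℝ, ξ ∈ Linf P →
      Tendsto (fun η : L1 P => pairing P ξ η.1) U (𝓝 x) := by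
    by_cases hξ : ξ ∈ Linf P
    · obtain ⟨B, hB⟩ := exists_abs_pairing_le_uiSet N hξ
      obtain ⟨x, -, hx⟩ := (isCompact_Icc (a := -B) (b := B)).ultrafilter_le_nhds
        (U.map fun η : L1 P => pairing P ξ η.1)
        (le_principal_iff.2 (hmem.mono fun η hη => abs_le.1 (hB η hη)))
      exact ⟨x, fun _ => hx⟩
    · exact ⟨0, fun h => absurd h hξ⟩
  choose ℓ hℓ using hex
  obtain ⟨η, hη⟩ := exists_pairing_eq_of_dominated (P := P) (ℓ := ℓ) (N := N)
    (fun ξ hξ ζ hζ => tendsto_nhds_unique (hℓ _ (Linf_add hξ hζ))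
      (((hℓ ξ hξ).add (hℓ ζ hζ)).congr fun η => (pairing_add_left hξ hζ η.2.2).symm))
    (fun c ξ hξ => tendsto_nhds_unique (hℓ _ (Linf_smul c hξ))
      (((hℓ ξ hξ).const_mul c).congr fun η => (pairing_smul_left c ξ η.1).symm))
    (fun k ξ hξ h1 => le_of_tendsto (hℓ ξ hξ) (hmem.mono fun η hη => hη k ξ hξ h1))
  refine ⟨η, fun k ξ hξ h1 => ?_, ?_⟩
  · rw [← hη ξ hξ]
    exact le_of_tendsto (hℓ ξ hξ) (hmem.mono fun η hη => hη k ξ hξ h1)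
  · refine tendsto_weakT_iff (u := fun η : L1 P => η).2 fun ξ => ?_
    have := hℓ ξ.1 ξ.2
    rw [hη ξ.1 ξ.2, pairing_comm] at this
    exact this.congr fun η => pairing_comm _ _

lemma uiSet_mem_dualSets [IsProbabilityMeasure P] {N : ℕ → ℝ} (hN : ∀ k, 0 ≤ N k) :
    uiSet P N ∈ dualSets P (Linf P) (L1 P) :=
  ⟨convex_uiSet N, balanced_uiSet hN, isCompact_uiSet N⟩

/-- The Mackey neighbourhood of zero given by the polar of `uiSet P N`, for suitable `N`, controls
the tails `P (|ξ| > a n)`. -/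
lemma measureReal_lt_abs_le_of_pairing [IsProbabilityMeasure P] {a c : ℕ → ℝ} (ha : ∀ n, 0 < a n)
    (hc : ∀ n, 0 < c n) (han : ∀ n : ℕ, n ≠ 0 → (n : ℝ) ≤ a n) {ξ : Ω → ℝ} (hξ : ξ ∈ Linf P)
    (h : ∀ η ∈ uiSet P fun k => ∑ j ∈ Finset.range (k + 1), 1 / (a j * c j),
      |pairing P ξ η.1| < 1) (n : ℕ) :
    P.real {ω | a n < |ξ ω|} ≤ c n := by
  by_contra! hlt
  set D : Set Ω := {ω | a n < |ξ ω|} with hD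
  have hDm : MeasurableSet D := measurableSet_lt measurable_const hξ.1.abs
  have hp : 0 < P.real D := (hc n).trans hlt
  have hap : 0 < a n * P.real D := mul_pos (ha n) hp
  let η : Ω → ℝ := D.indicator fun ω => ξ ω / |ξ ω| / (a n * P.real D)
  have hηabs (ω : Ω) : |η ω| ≤ D.indicator (fun _ => 1 / (a n * P.real D)) ω := by
    by_cases hω : ω ∈ D
    · have : 0 < |ξ ω| := (ha n).trans hω
      simp only [η, indicator_of_mem hω, abs_div, abs_abs, div_self this.ne', abs_of_pos hap]
      rfl
    · simp [η, hω]
  have hηle (ω : Ω) : |η ω| ≤ 1 / (a n * P.real D) :=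
    (hηabs ω).trans (indicator_le_self' (fun _ _ => by positivity) ω)
  have hηm : Measurable η := ((hξ.1.div hξ.1.abs).div_const _).indicator hDm
  have hηi : Integrable η P := by
    simpa using integrable_mul_of_ae_bound hηm.aestronglyMeasurable (ae_of_all _ hηle)
      (integrable_const (1 : ℝ))
  have hDi (r : ℝ) : ∫ ω, D.indicator (fun _ => r) ω ∂P = P.real D * r := by
    rw [integral_indicator_const r hDm, smul_eq_mul]
  have hmem : (⟨η, hηm, hηi⟩ : L1 P) ∈ uiSet P fun k =>
      ∑ j ∈ Finset.range (k + 1), 1 / (a j * c j) := by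
    intro k ζ hζ h1
    have hζi : Integrable ζ P := by
      simpa using Linf_integrable_mul hζ (integrable_const (1 : ℝ))
    have hnn (j : ℕ) : 0 ≤ 1 / (a j * c j) := (one_div_pos.2 (mul_pos (ha j) (hc j))).le
    have hN : 0 ≤ ∑ j ∈ Finset.range (k + 1), 1 / (a j * c j) := Finset.sum_nonneg fun j _ => hnn j
    have hI : 0 ≤ ∫ ω, |ζ ω| ∂P := integral_nonneg fun _ => abs_nonneg _
    rcases lt_or_ge k n with hk | hk
    · have hle : pairing P ζ η ≤ 1 / a n := by
        calc pairing P ζ η ≤ ∫ ω, D.indicator (fun _ => 1 / (a n * P.real D)) ω ∂P := by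
              refine integral_mono_ae (Linf_integrable_mul hζ hηi)
                ((integrable_const _).indicator hDm) ?_
              filter_upwards [h1] with ω hω
              refine ((le_abs_self _).trans_eq (abs_mul _ _)).trans ?_
              exact (mul_le_of_le_one_left (abs_nonneg _) hω).trans (hηabs ω)
          _ = 1 / a n := by
              rw [hDi]
              field_simp
      have hkn : (k : ℝ) + 1 ≤ a n := le_trans (by exact_mod_cast hk) (han n (by omega))
      have := one_div_le_one_div_of_le (by positivity) hkn
      have := mul_nonneg hN hI
      simp only
      linarith
    · have hle : 1 / (a n * P.real D) ≤ ∑ j ∈ Finset.range (k + 1), 1 / (a j * c j) :=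
        (one_div_le_one_div_of_le (mul_pos (ha n) (hc n))
          (mul_le_mul_of_nonneg_left hlt.le (ha n).le)).trans
          (Finset.single_le_sum (f := fun j => 1 / (a j * c j)) (fun j _ => hnn j)
            (Finset.mem_range.2 (by omega)))
      have : pairing P ζ η ≤ (∑ j ∈ Finset.range (k + 1), 1 / (a j * c j)) * ∫ ω, |ζ ω| ∂P := by
        rw [← integral_const_mul]
        refine integral_mono (Linf_integrable_mul hζ hηi) (hζi.abs.const_mul _) fun ω => ?_
        refine ((le_abs_self _).trans_eq (abs_mul _ _)).trans ?_
        rw [mul_comm]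
        exact mul_le_mul_of_nonneg_right ((hηle ω).trans hle) (abs_nonneg _)
      have : 0 ≤ 1 / ((k : ℝ) + 1) := by positivity
      simp only
      linarith
  have hge : 1 ≤ pairing P ξ η := by
    calc 1 = ∫ ω, D.indicator (fun _ => 1 / P.real D) ω ∂P := by
          rw [hDi]
          field_simp
      _ ≤ pairing P ξ η := by
          refine integral_mono ((integrable_const _).indicator hDm) (Linf_integrable_mul hξ hηi)
            fun ω => ?_
          by_cases hω : ω ∈ D
          · have hpos : 0 < |ξ ω| := (ha n).trans hω
            simp only [η, indicator_of_mem hω]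
            have e : ξ ω * (ξ ω / |ξ ω| / (a n * P.real D)) = |ξ ω| / (a n * P.real D) := by
              rw [mul_div_assoc', mul_div_assoc', ← abs_mul_abs_self (ξ ω), mul_div_assoc,
                div_self hpos.ne', mul_one]
            rw [e, div_le_div_iff₀ hp hap, one_mul]
            exact mul_le_mul_of_nonneg_right (le_of_lt hω) hp.le
          · simp [η, hω]
  exact absurd (h _ hmem) (not_lt.2 (hge.trans (le_abs_self _)))

/-- Sequential continuity in probability on bounded sets, in uniform `ε`-`δ` form. -/
lemma exists_delta_of_continuousInMeasure [IsProbabilityMeasure P] {f : (Ω → ℝ) → ℝ}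
    (h : ∀ (ξ : ℕ → Ω → ℝ) (ξ₀ : Ω → ℝ), (∀ n, ξ n ∈ Linf P) → ξ₀ ∈ Linf P →
      (∃ M : ℝ, ∀ n, linfNorm P (ξ n) ≤ M) → TendstoInMeasure P ξ atTop ξ₀ →
      Tendsto (fun n => f (ξ n)) atTop (𝓝 (f ξ₀)))
    {ξ₀ : Ω → ℝ} (hξ₀ : ξ₀ ∈ Linf P) (M : ℝ) {ε : ℝ} (hε : 0 < ε) :
    ∃ δ > 0, ∀ ζ ∈ Linf P, (∀ᵐ ω ∂P, |ζ ω| ≤ M) → P.real {ω | δ < |ζ ω|} ≤ δ →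
      f (ξ₀ + ζ) ≤ f ξ₀ + ε := by
  by_contra! hcon
  have hpos (n : ℕ) : (0 : ℝ) < 1 / ((n : ℝ) + 1) := Nat.one_div_pos_of_nat
  choose ζ hζ hζM hζP hζf using fun n : ℕ => hcon _ (hpos n)
  obtain ⟨C, hC⟩ := hξ₀.2
  have hlim : TendstoInMeasure P (fun n => ξ₀ + ζ n) atTop ξ₀ := by
    rw [tendstoInMeasure_iff_measureReal_norm]
    intro r hr
    refine squeeze_zero' (Eventually.of_forall fun _ => measureReal_nonneg) ?_
      tendsto_one_div_add_atTop_nhds_zero_nat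
    filter_upwards [tendsto_one_div_add_atTop_nhds_zero_nat.eventually_lt_const hr] with n hn
    refine le_trans (measureReal_mono fun ω hω => ?_) (hζP n)
    simp only [mem_ofPred_eq, Pi.add_apply, add_sub_cancel_left, Real.norm_eq_abs] at hω ⊢
    exact hn.trans_le hω
  have := h _ ξ₀ (fun n => Linf_add hξ₀ (hζ n)) hξ₀ ⟨|C| + |M|, fun n => linfNorm_le (by positivity)
    (by
      filter_upwards [hC, hζM n] with ω h1 h2
      exact (abs_add_le _ _).trans (add_le_add (h1.trans (le_abs_self _))
        (h2.trans (le_abs_self _))))⟩ hlim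
  obtain ⟨n, hn⟩ := (this.eventually_lt_const (lt_add_of_pos_right _ hε)).exists
  exact lt_asymm hn (hζf n)

/-- Splitting `ξ` along the levels of `|ξ|`, a convex function which is controlled near `ξ₀` on each
bounded set is controlled on the elements `ξ₀ + ξ` with small enough tails of `|ξ|`. -/
lemma le_add_of_measureReal_tail_le [IsProbabilityMeasure P] {f : (Ω → ℝ) → ℝ}
    (hf : ConvexOn ℝ (Linf P) f) {ξ₀ : Ω → ℝ} (hξ₀ : ξ₀ ∈ Linf P) {ε : ℝ} {δ : ℕ → ℝ}
    (hδ0 : ∀ n, 0 < δ n)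
    (hδ : ∀ n : ℕ, ∀ ζ ∈ Linf P, (∀ᵐ ω ∂P, |ζ ω| ≤ 2 ^ (n + 1) * ((n : ℝ) + 1)) →
      P.real {ω | δ n < |ζ ω|} ≤ δ n → f (ξ₀ + ζ) ≤ f ξ₀ + ε)
    {ξ : Ω → ℝ} (hξ : ξ ∈ Linf P) (h0 : P.real {ω | δ 0 / 2 < |ξ ω|} ≤ δ 0)
    (hn : ∀ n : ℕ, n ≠ 0 → P.real {ω | (n : ℝ) < |ξ ω|} ≤ δ n) :
    f (ξ₀ + ξ) ≤ f ξ₀ + ε := by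
  obtain ⟨C, hC⟩ := hξ.2
  obtain ⟨K, hK⟩ := exists_nat_ge C
  have hind {s : Set Ω} (hs : MeasurableSet s) : s.indicator ξ ∈ Linf P :=
    ⟨hξ.1.indicator hs, C, hC.mono fun ω hω => by
      by_cases h : ω ∈ s
      · simpa [h] using hω
      · simpa [h] using (abs_nonneg _).trans hω⟩
  have hTm (n : ℕ) : MeasurableSet {ω | (n : ℝ) < |ξ ω|} :=
    measurableSet_lt measurable_const hξ.1.abs
  have hDm (n : ℕ) : MeasurableSet {ω | (n : ℝ) < |ξ ω| ∧ |ξ ω| ≤ (n : ℝ) + 1} :=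
    (hTm n).inter (measurableSet_le hξ.1.abs measurable_const)
  let t : ℕ → Ω → ℝ := fun n => (2 : ℝ) ^ n • {ω | (n : ℝ) < |ξ ω|}.indicator ξ
  let ζ : ℕ → Ω → ℝ := fun n =>
    (2 : ℝ) ^ (n + 1) • {ω | (n : ℝ) < |ξ ω| ∧ |ξ ω| ≤ (n : ℝ) + 1}.indicator ξ
  have ht (n : ℕ) : t n ∈ Linf P := Linf_smul _ (hind (hTm n))
  have hζ (n : ℕ) : ζ n ∈ Linf P := Linf_smul _ (hind (hDm n))
  have hfζ (n : ℕ) : f (ξ₀ + ζ n) ≤ f ξ₀ + ε := by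
    refine hδ n _ (hζ n) (ae_of_all _ fun ω => ?_) ?_
    · by_cases h : (n : ℝ) < |ξ ω| ∧ |ξ ω| ≤ (n : ℝ) + 1
      · simp only [ζ, Pi.smul_apply, indicator, mem_ofPred_eq, h, smul_eq_mul, abs_mul,
          abs_pow, Nat.abs_ofNat]
        exact mul_le_mul_of_nonneg_left h.2 (by positivity)
      · simp only [ζ, Pi.smul_apply, indicator, mem_ofPred_eq, h, if_false, smul_zero, abs_zero]
        positivity
    · have hsub (ω : Ω) (hω : δ n < |ζ n ω|) :
          (n : ℝ) < |ξ ω| ∧ |ζ n ω| = 2 ^ (n + 1) * |ξ ω| := by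
        by_cases h : (n : ℝ) < |ξ ω| ∧ |ξ ω| ≤ (n : ℝ) + 1
        · simp [ζ, indicator, h, abs_mul]
        · simp only [ζ, Pi.smul_apply, indicator, mem_ofPred_eq, h, if_false, smul_zero,
            abs_zero] at hω
          exact absurd hω (hδ0 n).not_gt
      rcases eq_or_ne n 0 with rfl | hne
      · refine (measureReal_mono fun ω hω => ?_).trans h0
        have h1 := (hsub ω hω).2
        have h2 : δ 0 < |ζ 0 ω| := hω
        simp only [zero_add, pow_one] at h1
        change δ 0 / 2 < |ξ ω|
        linarith
      · exact (measureReal_mono fun ω hω => (hsub ω hω).1).trans (hn n hne)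
  have hft (m : ℕ) : ∀ n, K ≤ n + m → f (ξ₀ + t n) ≤ f ξ₀ + ε := by
    induction m with
    | zero =>
      intro n hKn
      have hz : ∀ᵐ ω ∂P, t n ω = 0 := by
        filter_upwards [hC] with ω hω
        have : ¬ (n : ℝ) < |ξ ω| := not_lt.2 (hω.trans (hK.trans (by exact_mod_cast hKn)))
        simp [t, this]
      refine hδ 0 _ (ht n) (hz.mono fun ω hω => by rw [hω, abs_zero]; positivity) ?_
      have : P {ω | δ 0 < |t n ω|} = 0 := by
        refine measure_mono_null (fun ω hω => ?_) hz
        rintro (h0 : t n ω = 0)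
        have hω' : δ 0 < |t n ω| := hω
        rw [h0, abs_zero] at hω'
        exact lt_asymm hω' (hδ0 0)
      rw [measureReal_def, this]
      exact (hδ0 0).le
    | succ m ih =>
      intro n hKn
      have e : ξ₀ + t n = (1 / 2 : ℝ) • (ξ₀ + ζ n) + (1 / 2 : ℝ) • (ξ₀ + t (n + 1)) := by
        ext ω
        simp only [t, ζ, Pi.add_apply, Pi.smul_apply, smul_eq_mul, indicator, mem_ofPred_eq,
          Nat.cast_add, Nat.cast_one]
        rcases lt_or_ge (n : ℝ) |ξ ω| with h1 | h1
        · rcases le_or_gt |ξ ω| ((n : ℝ) + 1) with h2 | h2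
          · simp only [h1, h2, h2.not_gt, and_self, if_true, if_false]
            ring
          · simp only [h1, h2, h2.not_ge, and_false, if_true, if_false]
            ring
        · have h2 : ¬ (n : ℝ) + 1 < |ξ ω| := by linarith
          simp only [h1.not_gt, h2, false_and, if_false]
          ring
      have hc := hf.2 (Linf_add hξ₀ (hζ n)) (Linf_add hξ₀ (ht (n + 1)))
        (by norm_num : (0 : ℝ) ≤ 1 / 2) (by norm_num : (0 : ℝ) ≤ 1 / 2) (by norm_num)
      rw [e]
      simp only [smul_eq_mul] at hc
      linarith [hfζ n, ih (n + 1) (by omega)]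
  have e : ξ = t 0 := by
    ext ω
    by_cases h : ξ ω = 0 <;> simp [t, indicator, h]
  rw [e]
  exact hft K 0 (by omega)

/-- A convex function on `L_∞` which is continuous in probability on bounded sets is
Mackey-continuous. -/
lemma continuous_mackeyT_of_continuousInMeasure [IsProbabilityMeasure P] {f : (Ω → ℝ) → ℝ}
    (hf : ConvexOn ℝ (Linf P) f)
    (h : ∀ (ξ : ℕ → Ω → ℝ) (ξ₀ : Ω → ℝ), (∀ n, ξ n ∈ Linf P) → ξ₀ ∈ Linf P →
      (∃ M : ℝ, ∀ n, linfNorm P (ξ n) ≤ M) → TendstoInMeasure P ξ atTop ξ₀ →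
      Tendsto (fun n => f (ξ n)) atTop (𝓝 (f ξ₀))) :
    @Continuous _ _ (mackeyT P (Linf P) (L1 P)) _ fun ξ : Linf P => f ξ.1 := by
  refine (@continuous_iff_continuousAt _ _ (mackeyT P (Linf P) (L1 P)) _ _).2 fun ξ₀ => ?_
  refine Metric.tendsto_nhds.2 fun ε hε => ?_
  choose δ hδ0 hδ using fun n : ℕ => exists_delta_of_continuousInMeasure h ξ₀.2
    (2 ^ (n + 1) * ((n : ℝ) + 1)) (half_pos hε)
  let a : ℕ → ℝ := fun n => if n = 0 then δ 0 / 2 else n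
  have ha (n : ℕ) : 0 < a n := by
    rcases eq_or_ne n 0 with rfl | hn
    · simpa [a] using hδ0 0
    · simpa [a, hn] using Nat.pos_of_ne_zero hn
  let N : ℕ → ℝ := fun k => ∑ j ∈ Finset.range (k + 1), 1 / (a j * δ j)
  have hN (k : ℕ) : 0 ≤ N k :=
    Finset.sum_nonneg fun j _ => (one_div_pos.2 (mul_pos (ha j) (hδ0 j))).le
  have key {ζ : Ω → ℝ} (hζ : ζ ∈ Linf P) (hp : ∀ η ∈ uiSet P N, |pairing P ζ η.1| < 1) :
      f (ξ₀.1 + ζ) ≤ f ξ₀.1 + ε / 2 := by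
    have htail := measureReal_lt_abs_le_of_pairing ha hδ0 (fun n hn => by simp [a, hn]) hζ hp
    exact le_add_of_measureReal_tail_le hf ξ₀.2 hδ0 hδ hζ (by simpa [a] using htail 0)
      fun n hn => by simpa [a, hn] using htail n
  have hnear := tendsto_mackeyT_iff.1
    (@tendsto_id _ (@nhds _ (mackeyT P (Linf P) (L1 P)) ξ₀)) _ (uiSet_mem_dualSets hN) 1 one_pos
  filter_upwards [hnear] with ξ hξ
  have h1 := key (Linf_sub ξ.2 ξ₀.2) fun η hη => by
    rw [pairing_sub_left ξ.2 ξ₀.2 η.2.2, abs_sub_comm]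
    exact hξ η hη
  have h2 := key (Linf_sub ξ₀.2 ξ.2) fun η hη => by
    rw [pairing_sub_left ξ₀.2 ξ.2 η.2.2]
    exact hξ η hη
  have h3 := hf.2 (Linf_add ξ₀.2 (Linf_sub ξ.2 ξ₀.2)) (Linf_add ξ₀.2 (Linf_sub ξ₀.2 ξ.2))
    (by norm_num : (0 : ℝ) ≤ 1 / 2) (by norm_num : (0 : ℝ) ≤ 1 / 2) (by norm_num)
  have e : (1 / 2 : ℝ) • (ξ₀.1 + (ξ.1 - ξ₀.1)) + (1 / 2 : ℝ) • (ξ₀.1 + (ξ₀.1 - ξ.1)) = ξ₀.1 := by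
    module
  rw [e] at h3
  rw [add_sub_cancel] at h1 h3
  simp only [smul_eq_mul] at h3
  rw [Real.dist_eq, abs_lt]
  constructor <;> linarith

end

/-- For a finite-valued convex function `f` on `L_∞`, Mackey
continuity, sequential Mackey continuity, and continuity in probability on
norm-bounded sets are all equivalent. -/
theorem statement0
    {Ω : Type*} [MeasurableSpace Ω] (P : Measure Ω) [IsProbabilityMeasure P]
    (f : (Ω → ℝ) → ℝ) (hf : ConvexOn ℝ (Linf P) f) :
    ((@Continuous _ _ (mackeyT P (Linf P) (L1 P)) _ fun ξ : Linf P => f ξ.1) ↔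
      (∀ (ξ : ℕ → Linf P) (ξ₀ : Linf P),
        Tendsto ξ atTop (@nhds _ (mackeyT P (Linf P) (L1 P)) ξ₀) →
        Tendsto (fun n => f (ξ n).1) atTop (𝓝 (f ξ₀.1)))) ∧
    ((@Continuous _ _ (mackeyT P (Linf P) (L1 P)) _ fun ξ : Linf P => f ξ.1) ↔
      (∀ (ξ : ℕ → Ω → ℝ) (ξ₀ : Ω → ℝ), (∀ n, ξ n ∈ Linf P) → ξ₀ ∈ Linf P →
        (∃ M : ℝ, ∀ n, linfNorm P (ξ n) ≤ M) →
        TendstoInMeasure P ξ atTop ξ₀ →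
        Tendsto (fun n => f (ξ n)) atTop (𝓝 (f ξ₀)))) := by
  have h12 (hc : @Continuous _ _ (mackeyT P (Linf P) (L1 P)) _ fun ξ : Linf P => f ξ.1)
      (ξ : ℕ → Linf P) (ξ₀ : Linf P)
      (hξ : Tendsto ξ atTop (@nhds _ (mackeyT P (Linf P) (L1 P)) ξ₀)) :
      Tendsto (fun n => f (ξ n).1) atTop (𝓝 (f ξ₀.1)) :=
    (@Continuous.tendsto _ _ (mackeyT P (Linf P) (L1 P)) _ _ hc ξ₀).comp hξ
  have h23 (hs : ∀ (ξ : ℕ → Linf P) (ξ₀ : Linf P),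
        Tendsto ξ atTop (@nhds _ (mackeyT P (Linf P) (L1 P)) ξ₀) →
        Tendsto (fun n => f (ξ n).1) atTop (𝓝 (f ξ₀.1)))
      (ξ : ℕ → Ω → ℝ) (ξ₀ : Ω → ℝ) (hξ : ∀ n, ξ n ∈ Linf P) (hξ₀ : ξ₀ ∈ Linf P)
      (hM : ∃ M : ℝ, ∀ n, linfNorm P (ξ n) ≤ M) (h : TendstoInMeasure P ξ atTop ξ₀) :
      Tendsto (fun n => f (ξ n)) atTop (𝓝 (f ξ₀)) :=
    let ⟨_, hM⟩ := hM
    hs (fun n => ⟨ξ n, hξ n⟩) ⟨ξ₀, hξ₀⟩ (tendsto_mackeyT_of_tendstoInMeasure hM h)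
  exact ⟨⟨h12, fun hs => continuous_mackeyT_of_continuousInMeasure hf (h23 hs)⟩,
    ⟨fun hc => h23 (h12 hc), continuous_mackeyT_of_continuousInMeasure hf⟩⟩

end OrliczPaper
end
end

section
/- Let Φ be a Young function (no Δ2-condition assumed). A set A ⊂ L_Φ is relatively compact for the weak topology σ(L_Φ,L_{Φ*}) induced by the pairing ⟨η,ξ⟩ = E[ηξ] with L_{Φ*} if and only if for every ξ ∈ L_{Φ*}, the set Aξ = {ηξ : η ∈ A} is uniformly integrable in L_1. -/
open MeasureTheory Filter Topology Set
open scoped ENNReal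

noncomputable section

namespace OrliczPaper

section Young

variable {Φ : ℝ → ℝ}

lemma IsYoung.nonneg (hΦ : IsYoung Φ) (x : ℝ) : 0 ≤ Φ x := by
  have h := hΦ.convexOn.2 (mem_univ x) (mem_univ (-x)) (by norm_num : (0 : ℝ) ≤ 1 / 2)
    (by norm_num : (0 : ℝ) ≤ 1 / 2) (by norm_num)
  have h0 : (1 / 2 : ℝ) • x + (1 / 2 : ℝ) • (-x) = 0 := by simp
  rw [h0, hΦ.map_zero, hΦ.even] at h
  simp only [smul_eq_mul] at h
  linarith

lemma IsYoung.map_abs (hΦ : IsYoung Φ) (x : ℝ) : Φ |x| = Φ x := by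
  rcases abs_choice x with h | h <;> rw [h]
  exact hΦ.even x

lemma IsYoung.bddAbove_conj (hΦ : IsYoung Φ) (y : ℝ) :
    BddAbove (range fun x : ℝ => x * y - Φ x) := by
  obtain ⟨R, hR⟩ := eventually_atTop.1 (hΦ.coercive.eventually_ge_atTop |y|)
  refine ⟨max R 1 * |y|, ?_⟩
  rintro _ ⟨x, rfl⟩
  have hxy : x * y ≤ |x| * |y| := by rw [← abs_mul]; exact le_abs_self _
  rcases le_total |x| (max R 1) with h | h
  · have := mul_le_mul_of_nonneg_right h (abs_nonneg y)
    have := hΦ.nonneg x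
    simp only
    linarith
  · have hx : 0 < |x| := by linarith [le_max_right R 1]
    have h2 := hR |x| ((le_max_left _ _).trans h)
    rw [le_div_iff₀ hx, hΦ.map_abs] at h2
    have : 0 ≤ max R 1 * |y| := by positivity
    simp only
    linarith

lemma IsYoung.young_le (hΦ : IsYoung Φ) (x y : ℝ) : x * y - Φ x ≤ conj Φ y :=
  le_ciSup (hΦ.bddAbove_conj y) x

lemma IsYoung.conj_nonneg (hΦ : IsYoung Φ) (y : ℝ) : 0 ≤ conj Φ y := by
  simpa [hΦ.map_zero] using hΦ.young_le 0 y

lemma IsYoung.conj_mono (hΦ : IsYoung Φ) {y z : ℝ} (h : |y| ≤ |z|) : conj Φ y ≤ conj Φ z := by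
  refine ciSup_le fun x => ?_
  have h1 : x * y ≤ |x| * |z| :=
    (le_abs_self _).trans ((abs_mul x y).le.trans (mul_le_mul_of_nonneg_left h (abs_nonneg x)))
  have h2 := hΦ.young_le |x| z
  have h3 := hΦ.young_le (-|x|) z
  rw [hΦ.even, hΦ.map_abs] at h3
  rw [hΦ.map_abs] at h2
  rcases abs_cases z with ⟨hz, _⟩ | ⟨hz, _⟩ <;> rw [hz] at h1 <;> nlinarith

lemma IsYoung.conj_zero (hΦ : IsYoung Φ) : conj Φ 0 = 0 := by
  refine le_antisymm (ciSup_le fun x => ?_) (hΦ.conj_nonneg 0)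
  have := hΦ.nonneg x
  linarith

lemma IsYoung.conj_mul_le (hΦ : IsYoung Φ) {t : ℝ} (ht : 0 ≤ t) (ht1 : t ≤ 1) (y : ℝ) :
    conj Φ (t * y) ≤ t * conj Φ y := by
  refine ciSup_le fun x => ?_
  have h1 := mul_le_mul_of_nonneg_left (hΦ.young_le x y) ht
  have h2 := hΦ.nonneg x
  nlinarith

lemma IsYoung.measurable (hΦ : IsYoung Φ) : Measurable Φ :=
  (continuousOn_univ.1 (hΦ.convexOn.continuousOn isOpen_univ)).measurable

lemma IsYoung.measurable_conj (hΦ : IsYoung Φ) : Measurable (conj Φ) := by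
  have hm : Monotone fun y : ℝ => conj Φ (max y 0) := fun y z h =>
    hΦ.conj_mono (by
      rw [abs_of_nonneg (le_max_right _ _), abs_of_nonneg (le_max_right _ _)]
      exact max_le_max_right 0 h)
  have h2 : conj Φ = (fun y : ℝ => conj Φ (max y 0)) ∘ fun y => |y| := by
    ext y
    simp only [Function.comp_apply, max_eq_left (abs_nonneg y)]
    exact le_antisymm (hΦ.conj_mono (by simp)) (hΦ.conj_mono (by simp))
  rw [h2]
  exact hm.measurable.comp measurable_norm

/-- The right derivative is a measurable selection of the subdifferential, along which Young's
inequality is an equality. -/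
lemma IsYoung.exists_monotone_subgradient (hΦ : IsYoung Φ) :
    ∃ φ : ℝ → ℝ, Monotone φ ∧ ∀ x, Φ x + conj Φ (φ x) ≤ x * φ x := by
  refine ⟨fun x => derivWithin Φ (Ioi x) x, ?_, fun x => ?_⟩
  · have := hΦ.convexOn.monotoneOn_rightDeriv
    rwa [interior_univ, monotoneOn_univ] at this
  set s := derivWithin Φ (Ioi x) x with hs
  suffices h : conj Φ s ≤ x * s - Φ x by linarith
  refine ciSup_le fun y => ?_
  have hx : x ∈ interior (univ : Set ℝ) := by simp
  rcases lt_trichotomy y x with h | h | h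
  · have h1 := (hΦ.convexOn.slope_le_leftDeriv_of_mem_interior (mem_univ y) hx h).trans
      (hΦ.convexOn.leftDeriv_le_rightDeriv_of_mem_interior hx)
    rw [slope_def_field, ← hs, div_le_iff₀ (by linarith)] at h1
    linarith
  · rw [h]
  · have h1 := hΦ.convexOn.rightDeriv_le_slope_of_mem_interior hx (mem_univ y) h
    rw [slope_def_field, ← hs, le_div_iff₀ (by linarith)] at h1
    linarith

end Young

section Kothe

variable {Ω : Type*} [MeasurableSpace Ω] {P : Measure Ω} {Φ : ℝ → ℝ}

lemma IsYoung.measurable_ofReal_comp (hΦ : IsYoung Φ) {g : Ω → ℝ} (hg : Measurable g) :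
    Measurable fun ω => ENNReal.ofReal (Φ (g ω)) :=
  (hΦ.measurable.comp hg).ennreal_ofReal

lemma IsYoung.measurable_ofReal_conj_comp (hΦ : IsYoung Φ) {g : Ω → ℝ} (hg : Measurable g) :
    Measurable fun ω => ENNReal.ofReal (conj Φ (g ω)) :=
  (hΦ.measurable_conj.comp hg).ennreal_ofReal

lemma IsYoung.integrable_mul (hΦ : IsYoung Φ) {f g : Ω → ℝ} (hf : MemOrlicz P Φ f)
    (hg : MemOrlicz P (conj Φ) g) : Integrable (fun ω => f ω * g ω) P := by
  obtain ⟨hfm, l, hl, hfl⟩ := hf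
  obtain ⟨hgm, m, hm, hgm'⟩ := hg
  have key : Integrable (fun ω => l * m * (f ω * g ω)) P := by
    refine ⟨by fun_prop, ?_⟩
    rw [hasFiniteIntegral_iff_norm]
    calc ∫⁻ ω, ENNReal.ofReal ‖l * m * (f ω * g ω)‖ ∂P
        ≤ ∫⁻ ω, (ENNReal.ofReal (Φ (l * f ω)) + ENNReal.ofReal (conj Φ (m * g ω))) ∂P := by
          refine lintegral_mono fun ω => ?_
          rw [← ENNReal.ofReal_add (hΦ.nonneg _) (hΦ.conj_nonneg _)]
          refine ENNReal.ofReal_le_ofReal ?_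
          have h1 := hΦ.young_le (l * f ω) (m * g ω)
          have h2 := hΦ.young_le (-(l * f ω)) (m * g ω)
          rw [hΦ.even] at h2
          rw [Real.norm_eq_abs, abs_le]
          constructor <;> linarith
      _ < ⊤ := by
          rw [lintegral_add_left (hΦ.measurable_ofReal_comp (by fun_prop))]
          exact ENNReal.add_lt_top.2 ⟨hfl, hgm'⟩
  exact (integrable_const_mul_iff (IsUnit.mk0 _ (mul_pos hl hm).ne') _).1 key

lemma IsYoung.memOrlicz_conj_of_abs_le (hΦ : IsYoung Φ) {g h : Ω → ℝ}
    (hg : MemOrlicz P (conj Φ) g) (hh : Measurable h) (hle : ∀ ω, |h ω| ≤ |g ω|) :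
    MemOrlicz P (conj Φ) h := by
  obtain ⟨hgm, m, hm, hgm'⟩ := hg
  refine ⟨hh, m, hm, lt_of_le_of_lt (lintegral_mono fun ω => ?_) hgm'⟩
  refine ENNReal.ofReal_le_ofReal (hΦ.conj_mono ?_)
  rw [abs_mul, abs_mul]
  exact mul_le_mul_of_nonneg_left (hle ω) (abs_nonneg m)

lemma memOrlicz_const [IsFiniteMeasure P] (Ψ : ℝ → ℝ) (c : ℝ) :
    MemOrlicz P Ψ fun _ : Ω => c := by
  refine ⟨measurable_const, 1, one_pos, ?_⟩
  rw [lintegral_const]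
  exact ENNReal.mul_lt_top ENNReal.ofReal_lt_top (measure_lt_top P _)

lemma IsYoung.exists_large_pairing [IsProbabilityMeasure P] (hΦ : IsYoung Φ) {f : Ω → ℝ}
    (hf : Measurable f) {l : ℝ} (hl : 0 < l)
    (hinf : ∫⁻ ω, ENNReal.ofReal (Φ (l * f ω)) ∂P = ⊤) :
    ∃ ξ : Ω → ℝ, Measurable ξ ∧ (∀ ω, 0 ≤ ξ ω) ∧
      ∫⁻ ω, ENNReal.ofReal (conj Φ (ξ ω)) ∂P ≤ 1 ∧
      1 ≤ ∫⁻ ω, ENNReal.ofReal (l * (|f ω| * ξ ω)) ∂P := by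
  obtain ⟨φ, hφ, hφΦ⟩ := hΦ.exists_monotone_subgradient
  have hU : (⋃ k : ℕ, {ω | |f ω| ≤ k}) = univ :=
    eq_univ_of_forall fun ω => mem_iUnion.2 (exists_nat_ge |f ω|)
  have hdir : Directed (· ⊆ ·) fun k : ℕ => {ω | |f ω| ≤ k} :=
    Monotone.directed_le fun i j hij ω (h : |f ω| ≤ i) => h.trans (by exact_mod_cast hij)
  have hsup := setLIntegral_iUnion_of_directed (μ := P)
    (fun ω => ENNReal.ofReal (Φ (l * f ω))) hdir
  rw [hU, setLIntegral_univ, hinf] at hsup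
  obtain ⟨k, hk⟩ := lt_iSup_iff.1 (hsup ▸ ENNReal.one_lt_top)
  set S : Set Ω := {ω | |f ω| ≤ k} with hS
  have hSm : MeasurableSet S := measurableSet_le (by fun_prop) measurable_const
  set ζ : Ω → ℝ := S.indicator fun ω => |φ (l * |f ω|)| with hζ
  have hζm : Measurable ζ :=
    (measurable_norm.comp (hφ.measurable.comp (by fun_prop))).indicator hSm
  have hζ0 : ∀ ω, 0 ≤ ζ ω := fun ω => indicator_nonneg (fun _ _ => abs_nonneg _) ω
  set C := max |φ 0| |φ (l * k)|
  have hζC : ∀ ω, |ζ ω| ≤ |C| := fun ω => by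
    rw [abs_of_nonneg (hζ0 ω), abs_of_nonneg (by positivity)]
    refine indicator_le' (g := fun _ => C) (fun ω hω => ?_) (fun _ _ => by positivity) ω
    exact abs_le_max_abs_abs (hφ (by positivity))
      (hφ (mul_le_mul_of_nonneg_left hω hl.le))
  have hpt : ∀ ω, S.indicator (fun ω => ENNReal.ofReal (Φ (l * f ω))) ω
      + ENNReal.ofReal (conj Φ (ζ ω)) ≤ ENNReal.ofReal (l * (|f ω| * ζ ω)) := fun ω => by
    by_cases hω : ω ∈ S
    · rw [hζ, indicator_of_mem hω, indicator_of_mem hω,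
        ← ENNReal.ofReal_add (hΦ.nonneg _) (hΦ.conj_nonneg _)]
      refine ENNReal.ofReal_le_ofReal ?_
      have h1 := hφΦ (l * |f ω|)
      have h2 : Φ (l * |f ω|) = Φ (l * f ω) := by
        rw [← hΦ.map_abs (l * f ω), abs_mul, abs_of_pos hl]
      have h3 : conj Φ |φ (l * |f ω|)| ≤ conj Φ (φ (l * |f ω|)) := hΦ.conj_mono (by simp)
      have h4 := mul_le_mul_of_nonneg_left (le_abs_self (φ (l * |f ω|)))
        (mul_nonneg hl.le (abs_nonneg (f ω)))
      linarith
    · rw [hζ, indicator_of_notMem hω, indicator_of_notMem hω, hΦ.conj_zero]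
      simp
  set b := ∫⁻ ω, ENNReal.ofReal (conj Φ (ζ ω)) ∂P with hb
  have hbtop : b ≠ ⊤ := by
    refine ne_top_of_le_ne_top (ENNReal.ofReal_ne_top (r := conj Φ C)) ?_
    calc b ≤ ∫⁻ _, ENNReal.ofReal (conj Φ C) ∂P :=
          lintegral_mono fun ω => ENNReal.ofReal_le_ofReal (hΦ.conj_mono (hζC ω))
      _ = _ := by simp
  have hlow : 1 + b ≤ ∫⁻ ω, ENNReal.ofReal (l * (|f ω| * ζ ω)) ∂P := by
    refine le_trans ?_ (lintegral_mono hpt)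
    rw [lintegral_add_right _ (hΦ.measurable_ofReal_conj_comp hζm),
      lintegral_indicator hSm]
    gcongr
  set t : ℝ := 1 / (1 + b.toReal) with ht
  have hb0 : 0 ≤ b.toReal := ENNReal.toReal_nonneg
  have ht0 : 0 < t := by positivity
  have ht1 : t ≤ 1 := by rw [ht, div_le_one (by positivity)]; linarith
  have htb : ENNReal.ofReal t * (1 + b) = 1 := by
    rw [← ENNReal.ofReal_toReal hbtop, ← ENNReal.ofReal_one, ← ENNReal.ofReal_add zero_le_one hb0,
      ← ENNReal.ofReal_mul ht0.le, ht, one_div, inv_mul_cancel₀ (by positivity)]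
  refine ⟨fun ω => t * ζ ω, by fun_prop, fun ω => mul_nonneg ht0.le (hζ0 ω), ?_, ?_⟩
  · calc ∫⁻ ω, ENNReal.ofReal (conj Φ (t * ζ ω)) ∂P
        ≤ ∫⁻ ω, ENNReal.ofReal t * ENNReal.ofReal (conj Φ (ζ ω)) ∂P := by
          refine lintegral_mono fun ω => ?_
          rw [← ENNReal.ofReal_mul ht0.le]
          exact ENNReal.ofReal_le_ofReal (hΦ.conj_mul_le ht0.le ht1 _)
      _ = ENNReal.ofReal t * b := lintegral_const_mul' _ _ ENNReal.ofReal_ne_top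
      _ ≤ ENNReal.ofReal t * (1 + b) := by gcongr; exact le_add_self
      _ = 1 := htb
  · calc (1 : ℝ≥0∞) = ENNReal.ofReal t * (1 + b) := htb.symm
      _ ≤ ENNReal.ofReal t * ∫⁻ ω, ENNReal.ofReal (l * (|f ω| * ζ ω)) ∂P := by gcongr
      _ = ∫⁻ ω, ENNReal.ofReal (l * (|f ω| * (t * ζ ω))) ∂P := by
          rw [← lintegral_const_mul' _ _ ENNReal.ofReal_ne_top]
          refine lintegral_congr fun ω => ?_
          rw [← ENNReal.ofReal_mul ht0.le]
          congr 1
          ring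

/-- The Köthe dual of `L_{Φ*}` is contained in `L_Φ`. -/
lemma IsYoung.memOrlicz_of_forall_integrable [IsProbabilityMeasure P] (hΦ : IsYoung Φ)
    {f : Ω → ℝ} (hf : Measurable f)
    (h_int : ∀ ξ, MemOrlicz P (conj Φ) ξ → Integrable (fun ω => f ω * ξ ω) P) :
    MemOrlicz P Φ f := by
  by_contra hcon
  have hinf : ∀ n : ℕ, ∫⁻ ω, ENNReal.ofReal (Φ ((1 / 4) ^ n * f ω)) ∂P = ⊤ := fun n => by
    by_contra h
    exact hcon ⟨hf, (1 / 4) ^ n, by positivity, lt_top_iff_ne_top.2 h⟩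
  choose ξ hξm hξ0 hξ1 hξf using fun n => hΦ.exists_large_pairing (P := P) hf
    (by positivity : (0 : ℝ) < (1 / 4) ^ n) (hinf n)
  set y : ℕ → Ω → ℝ := fun n ω => (1 / 2) ^ n * ξ n ω with hy
  have hym : ∀ n, Measurable (y n) := fun n => by fun_prop
  set c : Ω → ℝ≥0∞ := fun ω => ∑' n, ENNReal.ofReal (conj Φ (y n ω)) with hc
  have hcint : ∫⁻ ω, c ω ∂P < ⊤ := by
    rw [hc, lintegral_tsum fun n => (hΦ.measurable_ofReal_conj_comp (hym n)).aemeasurable]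
    refine lt_of_le_of_lt (b := ∑' n : ℕ, (ENNReal.ofReal (1 / 2)) ^ n) ?_ ?_
    · refine ENNReal.tsum_le_tsum fun n => ?_
      rw [← ENNReal.ofReal_pow (by norm_num)]
      calc ∫⁻ ω, ENNReal.ofReal (conj Φ (y n ω)) ∂P
          ≤ ∫⁻ ω, ENNReal.ofReal ((1 / 2) ^ n) * ENNReal.ofReal (conj Φ (ξ n ω)) ∂P := by
            refine lintegral_mono fun ω => ?_
            rw [← ENNReal.ofReal_mul (by positivity)]
            exact ENNReal.ofReal_le_ofReal
              (hΦ.conj_mul_le (by positivity) (pow_le_one₀ (by norm_num) (by norm_num)) _)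
        _ = ENNReal.ofReal ((1 / 2) ^ n) * ∫⁻ ω, ENNReal.ofReal (conj Φ (ξ n ω)) ∂P :=
            lintegral_const_mul' _ _ ENNReal.ofReal_ne_top
        _ ≤ ENNReal.ofReal ((1 / 2) ^ n) * 1 := by gcongr; exact hξ1 n
        _ = _ := mul_one _
    · rw [ENNReal.tsum_geometric, ENNReal.inv_lt_top, tsub_pos_iff_lt, ← ENNReal.ofReal_one]
      exact (ENNReal.ofReal_lt_ofReal_iff one_pos).2 (by norm_num)
  have hcfin : ∀ᵐ ω ∂P, c ω < ⊤ := by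
    refine ae_lt_top ?_ hcint.ne
    exact Measurable.tsum fun n => hΦ.measurable_ofReal_conj_comp (hym n)
  have hle : ∀ᵐ ω ∂P, ∀ n, conj Φ (y n ω) ≤ (c ω).toReal := by
    filter_upwards [hcfin] with ω hω n
    rw [← ENNReal.ofReal_le_iff_le_toReal hω.ne]
    exact ENNReal.le_tsum n
  have hbdd : ∀ᵐ ω ∂P, BddAbove (range fun n => y n ω) := by
    filter_upwards [hle] with ω hω
    refine ⟨(c ω).toReal + Φ 1, ?_⟩
    rintro _ ⟨n, rfl⟩
    have := hΦ.young_le 1 (y n ω)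
    linarith [hω n]
  have hmem : MemOrlicz P (conj Φ) fun ω => ⨆ n, y n ω := by
    refine ⟨Measurable.iSup hym, 1, one_pos, lt_of_le_of_lt (lintegral_mono_ae ?_) hcint⟩
    filter_upwards [hcfin, hle, hbdd] with ω hω hω2 hω3
    rw [ENNReal.ofReal_le_iff_le_toReal hω.ne, one_mul]
    refine ciSup_le fun x => ?_
    have hs0 : 0 ≤ ⨆ n, y n ω := Real.iSup_nonneg fun n => by
      have := hξ0 n ω; positivity
    rcases le_or_gt x 0 with hx | hx
    · have := mul_nonpos_of_nonpos_of_nonneg hx hs0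
      have := hΦ.nonneg x
      have : 0 ≤ (c ω).toReal := ENNReal.toReal_nonneg
      linarith
    · have : (⨆ n, y n ω) ≤ ((c ω).toReal + Φ x) / x := by
        refine ciSup_le fun n => ?_
        rw [le_div_iff₀ hx]
        have := hΦ.young_le x (y n ω)
        linarith [hω2 n]
      rw [le_div_iff₀ hx] at this
      linarith
  have hI := h_int _ hmem
  have hlow : ∀ n : ℕ, ENNReal.ofReal (2 ^ n) ≤
      ∫⁻ ω, ENNReal.ofReal ‖f ω * ⨆ n, y n ω‖ ∂P := fun n => by
    calc ENNReal.ofReal (2 ^ n)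
        ≤ ENNReal.ofReal (2 ^ n) *
          ∫⁻ ω, ENNReal.ofReal ((1 / 4) ^ n * (|f ω| * ξ n ω)) ∂P := by
          nth_rewrite 1 [← mul_one (ENNReal.ofReal (2 ^ n))]
          gcongr
          exact hξf n
      _ = ∫⁻ ω, ENNReal.ofReal (|f ω| * y n ω) ∂P := by
          rw [← lintegral_const_mul' _ _ ENNReal.ofReal_ne_top]
          refine lintegral_congr fun ω => ?_
          rw [← ENNReal.ofReal_mul (by positivity)]
          congr 1
          have : (2 : ℝ) ^ n * (1 / 4) ^ n = (1 / 2) ^ n := by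
            rw [← mul_pow]; norm_num
          rw [← mul_assoc, this]
          ring
      _ ≤ _ := by
          refine lintegral_mono_ae ?_
          filter_upwards [hbdd] with ω hω
          refine ENNReal.ofReal_le_ofReal ?_
          rw [norm_mul, Real.norm_eq_abs]
          exact mul_le_mul_of_nonneg_left ((le_ciSup hω n).trans (le_abs_self _)) (abs_nonneg _)
  have hfin := hI.hasFiniteIntegral
  rw [hasFiniteIntegral_iff_norm] at hfin
  obtain ⟨n, hn⟩ := pow_unbounded_of_one_lt
    (∫⁻ ω, ENNReal.ofReal ‖f ω * ⨆ n, y n ω‖ ∂P).toReal (one_lt_two (α := ℝ))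
  have := hlow n
  rw [ENNReal.ofReal_le_iff_le_toReal hfin.ne] at this
  linarith

end Kothe

section UniformIntegrability

variable {Ω : Type*} [MeasurableSpace Ω] {P : Measure Ω}

lemma ofReal_setIntegral_abs {f : Ω → ℝ} (hf : Integrable f P) (S : Set Ω) :
    ENNReal.ofReal (∫ ω in S, |f ω| ∂P) = ∫⁻ ω in S, ENNReal.ofReal |f ω| ∂P :=
  ofReal_integral_eq_lintegral_ofReal hf.abs.integrableOn (ae_of_all _ fun _ => abs_nonneg _)

lemma setIntegral_abs_le_add [IsFiniteMeasure P] {f : Ω → ℝ} (hfm : Measurable f)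
    (hf : Integrable f P) {N : ℝ} (hN : 0 ≤ N) (S : Set Ω) :
    ∫ ω in S, |f ω| ∂P ≤ N * P.real S + ∫ ω in {ω | N < |f ω|}, |f ω| ∂P := by
  have hT : MeasurableSet {ω | N < |f ω|} := measurableSet_lt measurable_const (by fun_prop)
  have hI : Integrable ({ω | N < |f ω|}.indicator fun ω => |f ω|) P := hf.abs.indicator hT
  calc ∫ ω in S, |f ω| ∂P
      ≤ ∫ ω in S, (N + {ω | N < |f ω|}.indicator (fun ω => |f ω|) ω) ∂P := by
        refine setIntegral_mono hf.abs.integrableOn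
          ((integrable_const N).add hI).integrableOn fun ω => ?_
        by_cases hω : N < |f ω|
        · rw [indicator_of_mem (show ω ∈ {ω | N < |f ω|} from hω)]
          linarith
        · rw [indicator_of_notMem (show ω ∉ {ω | N < |f ω|} from hω)]
          linarith
    _ = N * P.real S + ∫ ω in S, {ω | N < |f ω|}.indicator (fun ω => |f ω|) ω ∂P := by
        rw [integral_add (integrable_const N).integrableOn hI.integrableOn, setIntegral_const,
          smul_eq_mul, mul_comm]
    _ ≤ N * P.real S + ∫ ω, {ω | N < |f ω|}.indicator (fun ω => |f ω|) ω ∂P := by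
        refine add_le_add le_rfl (setIntegral_le_integral hI (ae_of_all _ fun ω => ?_))
        exact indicator_nonneg (fun _ _ => abs_nonneg _) ω
    _ = _ := by rw [integral_indicator hT]

lemma UnifInt.exists_tail_le {B : Set (Ω → ℝ)} (h : UnifInt P B)
    (hB : ∀ f ∈ B, Integrable f P) {ε : ℝ} (hε : 0 < ε) :
    ∃ N : ℕ, ∀ f ∈ B, ∫ ω in {ω | (N : ℝ) < |f ω|}, |f ω| ∂P ≤ ε := by
  obtain ⟨N, hN⟩ := ENNReal.tendsto_atTop_zero.1 h (ENNReal.ofReal ε) (ENNReal.ofReal_pos.2 hε)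
  refine ⟨N, fun f hf => ?_⟩
  rw [← ENNReal.ofReal_le_ofReal_iff hε.le, ofReal_setIntegral_abs (hB f hf)]
  exact (le_iSup₂ (f := fun (f : Ω → ℝ) (_ : f ∈ B) =>
    ∫⁻ ω in {ω | (N : ℝ) < |f ω|}, ENNReal.ofReal |f ω| ∂P) f hf).trans (hN N le_rfl)

lemma UnifInt.exists_integral_abs_le [IsProbabilityMeasure P] {B : Set (Ω → ℝ)}
    (h : UnifInt P B) (hBm : ∀ f ∈ B, Measurable f) (hB : ∀ f ∈ B, Integrable f P) :
    ∃ C : ℝ, ∀ f ∈ B, ∫ ω, |f ω| ∂P ≤ C := by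
  obtain ⟨N, hN⟩ := h.exists_tail_le hB one_pos
  refine ⟨N + 1, fun f hf => ?_⟩
  have := setIntegral_abs_le_add (hBm f hf) (hB f hf) N.cast_nonneg univ
  rw [setIntegral_univ, probReal_univ] at this
  linarith [hN f hf]

lemma UnifInt.exists_setIntegral_abs_le [IsProbabilityMeasure P] {B : Set (Ω → ℝ)}
    (h : UnifInt P B) (hBm : ∀ f ∈ B, Measurable f) (hB : ∀ f ∈ B, Integrable f P)
    {ε : ℝ} (hε : 0 < ε) :
    ∃ δ > 0, ∀ S, MeasurableSet S → P.real S ≤ δ → ∀ f ∈ B, ∫ ω in S, |f ω| ∂P ≤ ε := by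
  obtain ⟨N, hN⟩ := h.exists_tail_le hB (half_pos hε)
  refine ⟨ε / (2 * (N + 1)), by positivity, fun S _ hPS f hf => ?_⟩
  have h1 := setIntegral_abs_le_add (hBm f hf) (hB f hf) N.cast_nonneg S
  rw [le_div_iff₀ (by positivity)] at hPS
  have : 0 ≤ P.real S := measureReal_nonneg
  nlinarith [hN f hf]

lemma unifInt_of_forall_setIntegral_abs_le [IsProbabilityMeasure P] {B : Set (Ω → ℝ)}
    (hBm : ∀ f ∈ B, Measurable f) (hB : ∀ f ∈ B, Integrable f P)
    (hC : ∃ C : ℝ, ∀ f ∈ B, ∫ ω, |f ω| ∂P ≤ C)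
    (hδ : ∀ ε > 0, ∃ δ > 0, ∀ S, MeasurableSet S → P.real S ≤ δ →
      ∀ f ∈ B, ∫ ω in S, |f ω| ∂P ≤ ε) : UnifInt P B := by
  obtain ⟨C, hC⟩ := hC
  refine ENNReal.tendsto_atTop_zero.2 fun ε hε => ?_
  obtain ⟨r, hr0, hrε⟩ := ENNReal.lt_iff_exists_nnreal_btwn.1 hε
  obtain ⟨δ, hδ0, hδ⟩ := hδ r (by exact_mod_cast hr0)
  obtain ⟨N, hN⟩ := exists_nat_gt (C / δ)
  refine ⟨N + 1, fun n hn => iSup₂_le fun f hf => ?_⟩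
  rw [← ofReal_setIntegral_abs (hB f hf)]
  refine le_trans (ENNReal.ofReal_le_ofReal (hδ _ ?_ ?_ f hf)) (by simpa using hrε.le)
  · exact measurableSet_lt measurable_const ((hBm f hf).norm)
  · have hn0 : (0 : ℝ) < n := by exact_mod_cast (Nat.succ_pos N).trans_le hn
    have h1 := mul_meas_ge_le_integral_of_nonneg (ae_of_all P fun ω => abs_nonneg (f ω))
      (hB f hf).abs n
    have h2 : P.real {ω | (n : ℝ) < |f ω|} ≤ P.real {ω | (n : ℝ) ≤ |f ω|} :=
      measureReal_mono fun ω (hω : (n : ℝ) < |f ω|) => hω.le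
    have h3 : (n : ℝ) * P.real {ω | (n : ℝ) < |f ω|} ≤ C :=
      (mul_le_mul_of_nonneg_left h2 hn0.le).trans (h1.trans (hC f hf))
    have h4 : C < n * δ := by
      rw [div_lt_iff₀ hδ0] at hN
      have : (N : ℝ) ≤ n := by exact_mod_cast (Nat.le_succ N).trans hn
      nlinarith
    nlinarith

end UniformIntegrability

section DunfordPettis

variable {Ω : Type*} [MeasurableSpace Ω] {P : Measure Ω}

/-- Every sequence in `B` converges along a fixed free ultrafilter to an integrable function, for
the topology of pairing with bounded measurable functions. -/
def HasWeakUltralimits (P : Measure Ω) (B : Set (Ω → ℝ)) : Prop :=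
  ∀ x : ℕ → Ω → ℝ, (∀ k, x k ∈ B) → ∃ f : Ω → ℝ, Integrable f P ∧
    ∀ h : Ω → ℝ, Measurable h → (∀ ω, |h ω| ≤ 1) →
      Tendsto (fun k => ∫ ω, x k ω * h ω ∂P) (hyperfilter ℕ) (𝓝 (∫ ω, f ω * h ω ∂P))

lemma exists_measurable_sign {f : Ω → ℝ} (hf : Measurable f) :
    ∃ s : Ω → ℝ, Measurable s ∧ (∀ ω, |s ω| ≤ 1) ∧ ∀ ω, f ω * s ω = |f ω| := by
  classical
  refine ⟨fun ω => if 0 ≤ f ω then 1 else -1,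
    Measurable.ite (measurableSet_le measurable_const hf) measurable_const measurable_const,
    fun ω => ?_, fun ω => ?_⟩
  · dsimp only; split_ifs <;> simp
  · dsimp only
    split_ifs with h
    · rw [abs_of_nonneg h, mul_one]
    · rw [abs_of_neg (not_le.1 h)]; ring

lemma integrable_mul_of_abs_le_one {f g : Ω → ℝ} (hf : Integrable f P) (hg : Measurable g)
    (hg1 : ∀ ω, |g ω| ≤ 1) : Integrable (fun ω => f ω * g ω) P :=
  hf.mul_bdd (c := 1) hg.aestronglyMeasurable (ae_of_all _ hg1)

lemma abs_setIntegral_mul_le {f g : Ω → ℝ} (hf : Integrable f P)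
    (hg1 : ∀ ω, |g ω| ≤ 1) {S T : Set Ω} (hST : S ⊆ T) :
    |∫ ω in S, f ω * g ω ∂P| ≤ ∫ ω in T, |f ω| ∂P := by
  calc |∫ ω in S, f ω * g ω ∂P| ≤ ∫ ω in S, |f ω| ∂P := by
        rw [← Real.norm_eq_abs]
        refine norm_integral_le_of_norm_le hf.abs.integrableOn (ae_of_all _ fun ω => ?_)
        rw [Real.norm_eq_abs, abs_mul]
        exact mul_le_of_le_one_right (abs_nonneg _) (hg1 ω)
    _ ≤ _ := setIntegral_mono_set hf.abs.integrableOn (ae_of_all _ fun _ => abs_nonneg _)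
        hST.eventuallyLE

lemma tendsto_setIntegral_tail_of_disjoint {f : Ω → ℝ} (hf : Integrable f P) {S : ℕ → Set Ω}
    (hS : ∀ k, MeasurableSet (S k)) (hd : Pairwise fun i j => Disjoint (S i) (S j)) :
    Tendsto (fun N : ℕ => ∫ ω in ⋃ i ∈ Ici N, S i, |f ω| ∂P) atTop (𝓝 0) := by
  have h := tendsto_setIntegral_of_antitone (μ := P) (f := fun ω => |f ω|)
    (s := fun N : ℕ => ⋃ i ∈ Ici N, S i)
    (fun N => MeasurableSet.biUnion (to_countable _) fun i _ => hS i)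
    (fun M N hMN => biUnion_subset_biUnion_left (Ici_subset_Ici.2 hMN))
    ⟨0, hf.abs.integrableOn⟩
  have hempty : (⋂ N : ℕ, ⋃ i ∈ Ici N, S i) = ∅ := by
    refine eq_empty_of_forall_notMem fun ω hω => ?_
    rw [mem_iInter] at hω
    obtain ⟨i, -, hi⟩ := mem_iUnion₂.1 (hω 0)
    obtain ⟨j, hj, hj'⟩ := mem_iUnion₂.1 (hω (i + 1))
    exact disjoint_left.1 (hd (Nat.lt_of_succ_le hj).ne) hi hj'
  rwa [hempty, setIntegral_empty] at h

lemma HasWeakUltralimits.exists_abs_integral_le {B : Set (Ω → ℝ)} (hW : HasWeakUltralimits P B)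
    {h : Ω → ℝ} (hh : Measurable h) (hh1 : ∀ ω, |h ω| ≤ 1) :
    ∃ C : ℝ, ∀ f ∈ B, |∫ ω, f ω * h ω ∂P| ≤ C := by
  by_contra! hcon
  choose x hxB hx using fun k : ℕ => hcon k
  obtain ⟨f, -, hf⟩ := hW x hxB
  have h1 := (hf h hh hh1).abs
  have h2 : Tendsto (fun k => |∫ ω, x k ω * h ω ∂P|) (hyperfilter ℕ) atTop :=
    tendsto_atTop_mono (fun k => (hx k).le)
      (tendsto_natCast_atTop_atTop.mono_left Nat.hyperfilter_le_atTop)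
  exact not_tendsto_nhds_of_tendsto_atTop h2 _ h1

lemma HasWeakUltralimits.exists_integral_abs_le [IsProbabilityMeasure P] {B : Set (Ω → ℝ)}
    (hW : HasWeakUltralimits P B) (hBm : ∀ f ∈ B, Measurable f) (hB : ∀ f ∈ B, Integrable f P) :
    ∃ C : ℝ, ∀ f ∈ B, ∫ ω, |f ω| ∂P ≤ C := by
  set g : B → (Lp ℝ ⊤ P →L[ℝ] ℝ) := fun f =>
    (ContinuousLinearMap.mul ℝ ℝ).lpPairing P 1 ⊤ ((hB f f.2).toL1 f) with hg
  have hgi : ∀ (f : B) (u : Lp ℝ ⊤ P), g f u = ∫ ω, (f : Ω → ℝ) ω * u ω ∂P := fun f u => by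
    rw [hg, ContinuousLinearMap.lpPairing_eq_integral]
    refine integral_congr_ae ?_
    filter_upwards [(hB f f.2).coeFn_toL1] with ω hω
    rw [ContinuousLinearMap.mul_apply', hω]
  obtain ⟨C, hC⟩ := banach_steinhaus (g := g) fun u => by
    set R : ℝ := ‖u‖ + 1
    have hR : 0 < R := by positivity
    set h : Ω → ℝ := fun ω => max (-1) (min 1 (u ω / R)) with hh
    have hum : Measurable u := (Lp.stronglyMeasurable u).measurable
    obtain ⟨C, hC⟩ := hW.exists_abs_integral_le (h := h) (by fun_prop) fun ω => by
      rw [abs_le]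
      exact ⟨le_max_left _ _, max_le (by norm_num) (min_le_left _ _)⟩
    refine ⟨R * C, fun f => ?_⟩
    have hle : ∀ᵐ ω ∂P, ‖u ω‖ ≤ ‖u‖ := by
      filter_upwards [ae_le_eLpNormEssSup (f := u) (μ := P)] with ω hω
      rw [Lp.norm_def, eLpNorm_exponent_top, ← toReal_enorm]
      exact ENNReal.toReal_mono (eLpNorm_exponent_top (f := u) (μ := P) ▸ Lp.eLpNorm_ne_top u) hω
    have hae : ∀ᵐ ω ∂P, (f : Ω → ℝ) ω * u ω = R * ((f : Ω → ℝ) ω * h ω) := by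
      filter_upwards [hle] with ω hω
      have h1 : |u ω / R| ≤ 1 := by
        rw [abs_div, abs_of_pos hR, div_le_one hR, ← Real.norm_eq_abs]
        linarith
      rw [abs_le] at h1
      rw [hh]
      dsimp only
      rw [min_eq_right h1.2, max_eq_right h1.1]
      field_simp
    rw [hgi, integral_congr_ae hae, integral_const_mul, norm_mul, Real.norm_eq_abs,
      abs_of_pos hR]
    exact mul_le_mul_of_nonneg_left (hC f f.2) hR.le
  refine ⟨C, fun f hf => ?_⟩
  obtain ⟨s, hsm, hs1, hfs⟩ := exists_measurable_sign (hBm f hf)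
  have hmem : MemLp s ⊤ P := memLp_top_of_bound hsm.aestronglyMeasurable 1 (ae_of_all _ hs1)
  have hnorm : ‖hmem.toLp s‖ ≤ 1 := by
    refine (Lp.norm_le_of_ae_bound zero_le_one ?_).trans (by simp)
    filter_upwards [hmem.coeFn_toLp] with ω hω
    rw [hω]
    exact hs1 ω
  have heq : g ⟨f, hf⟩ (hmem.toLp s) = ∫ ω, |f ω| ∂P := by
    rw [hgi]
    refine integral_congr_ae ?_
    filter_upwards [hmem.coeFn_toLp] with ω hω
    rw [hω, hfs]
  rw [← heq]
  calc g ⟨f, hf⟩ (hmem.toLp s) ≤ ‖g ⟨f, hf⟩ (hmem.toLp s)‖ := le_abs_self _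
    _ ≤ ‖g ⟨f, hf⟩‖ * ‖hmem.toLp s‖ := ContinuousLinearMap.le_opNorm _ _
    _ ≤ ‖g ⟨f, hf⟩‖ * 1 := by gcongr
    _ ≤ C := by rw [mul_one]; exact hC _

/-- Gliding hump: a family with weak ultralimits has no mass escaping along disjoint sets. -/
lemma HasWeakUltralimits.exists_setIntegral_abs_lt_of_disjoint {B : Set (Ω → ℝ)}
    (hW : HasWeakUltralimits P B) (hBm : ∀ f ∈ B, Measurable f) (hB : ∀ f ∈ B, Integrable f P)
    {ε : ℝ} (hε : 0 < ε) {x : ℕ → Ω → ℝ} (hx : ∀ k, x k ∈ B) {S : ℕ → Set Ω}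
    (hS : ∀ k, MeasurableSet (S k)) (hd : Pairwise fun i j => Disjoint (S i) (S j)) :
    ∃ k, ∫ ω in S k, |x k ω| ∂P < ε := by
  by_contra! hcon
  have hxi : ∀ k, Integrable (x k) P := fun k => hB _ (hx k)
  obtain ⟨G, hGm, hG1, hGS⟩ : ∃ G : Ω → ℝ, Measurable G ∧ (∀ ω, |G ω| ≤ 1) ∧
      ∀ k, ∀ ω ∈ S k, x k ω * G ω = |x k ω| := by
    choose s hsm hs1 hxs using fun k => exists_measurable_sign (hBm _ (hx k))
    obtain ⟨G, hGm, hGs⟩ := exists_measurable_piecewise S hS s hsm fun i j hij => by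
      change EqOn (s i) (s j) (S i ∩ S j)
      rw [(hd hij).inter_eq]
      exact eqOn_empty _ _
    refine ⟨fun ω => max (-1) (min 1 (G ω)), by fun_prop, fun ω => ?_, fun k ω hω => ?_⟩
    · rw [abs_le]
      exact ⟨le_max_left _ _, max_le (by norm_num) (min_le_left _ _)⟩
    · have h1 := abs_le.1 (hs1 k ω)
      dsimp only
      rw [hGs k hω, min_eq_right h1.2, max_eq_right h1.1, hxs]
  set U : Set ℕ → Set Ω := fun T => ⋃ i ∈ T, S i with hU
  have hUm : ∀ T, MeasurableSet (U T) := fun T =>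
    MeasurableSet.biUnion (to_countable T) fun i _ => hS i
  have hUmono : ∀ {T T' : Set ℕ}, T ⊆ T' → U T ⊆ U T' := fun h => biUnion_subset_biUnion_left h
  have hUd : ∀ {T T' : Set ℕ}, Disjoint T T' → Disjoint (U T) (U T') := fun h => by
    rw [hU, disjoint_iUnion₂_left]
    intro i hi
    rw [disjoint_iUnion₂_right]
    exact fun j hj => hd fun hij => disjoint_left.1 h hi (hij ▸ hj)
  have hlim : ∀ y : ℕ → Ω → ℝ, (∀ k, y k ∈ B) → ∃ f : Ω → ℝ, Integrable f P ∧ ∀ T : Set ℕ,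
      Tendsto (fun k => ∫ ω in U T, y k ω * G ω ∂P) (hyperfilter ℕ)
        (𝓝 (∫ ω in U T, f ω * G ω ∂P)) := fun y hy => by
    obtain ⟨f, hf, hlim⟩ := hW y hy
    refine ⟨f, hf, fun T => ?_⟩
    have := hlim ((U T).indicator G) (hGm.indicator (hUm T)) fun ω =>
      (norm_indicator_le_norm_self G ω).trans (hG1 ω)
    simpa only [← indicator_mul_right, integral_indicator (hUm T)] using this
  obtain ⟨f, hf, hlimf⟩ := hlim x hx
  obtain ⟨N₀, hN₀⟩ := ((tendsto_setIntegral_tail_of_disjoint hf hS hd).eventually_le_const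
    (by positivity : 0 < ε / 8)).exists
  have hnext : ∀ m : ℕ, ∃ m', m < m' ∧
      (∀ V ∈ (Finset.range (m + 1)).powerset,
        |∫ ω in U V, x m' ω * G ω ∂P - ∫ ω in U V, f ω * G ω ∂P| ≤ ε / 8) ∧
      ∫ ω in U (Ici m'), |x m ω| ∂P ≤ ε / 8 := fun m => by
    have h1 : ∀ᶠ m' in (hyperfilter ℕ : Filter ℕ), m < m' :=
      Nat.hyperfilter_le_atTop (eventually_gt_atTop m)
    have h2 : ∀ᶠ m' in (hyperfilter ℕ : Filter ℕ), ∀ V ∈ (Finset.range (m + 1)).powerset,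
        |∫ ω in U V, x m' ω * G ω ∂P - ∫ ω in U V, f ω * G ω ∂P| ≤ ε / 8 := by
      rw [Filter.eventually_all_finset]
      intro V _
      filter_upwards [Metric.tendsto_nhds.1 (hlimf V) (ε / 8) (by positivity)] with k hk
      exact hk.le
    have h3 : ∀ᶠ m' in (hyperfilter ℕ : Filter ℕ), ∫ ω in U (Ici m'), |x m ω| ∂P ≤ ε / 8 :=
      Nat.hyperfilter_le_atTop ((tendsto_setIntegral_tail_of_disjoint (hxi m) hS
        hd).eventually_le_const (by positivity : 0 < ε / 8))
    exact (h1.and (h2.and h3)).exists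
  choose next hlt hfin htail using hnext
  set M : ℕ → ℕ := fun j => next^[j] N₀ with hM
  have hMs : ∀ j, M (j + 1) = next (M j) := fun j => Function.iterate_succ_apply' next j N₀
  have hMmono : StrictMono M := strictMono_nat_of_lt_succ fun j => by rw [hMs]; exact hlt _
  have hlow : ∀ N j, N ≤ j → ε / 2 ≤ ∫ ω in U (M '' Ici N), x (M j) ω * G ω ∂P := by
    intro N j hNj
    set V : Finset ℕ := (Finset.Ico N j).image M with hV
    have hsplit : M '' Ici N = (↑V ∪ {M j}) ∪ M '' Ici (j + 1) := by
      rw [hV, Finset.coe_image, Finset.coe_Ico, ← image_singleton, ← image_union, ← image_union]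
      congr 1
      ext i
      simp only [mem_Ici, mem_union, mem_Ico, mem_singleton_iff]
      omega
    have hVlt : ∀ i ∈ V, i < M j := fun i hi => by
      obtain ⟨t, ht, rfl⟩ := Finset.mem_image.1 hi
      exact hMmono (Finset.mem_Ico.1 ht).2
    have hgt : M '' Ici (j + 1) ⊆ Ici (next (M j)) := by
      rintro _ ⟨t, ht, rfl⟩
      rw [← hMs]
      exact hMmono.monotone ht
    have hd1 : Disjoint (↑V : Set ℕ) {M j} := by
      rw [disjoint_singleton_right]
      exact fun h => (hVlt _ h).ne rfl
    have hd2 : Disjoint ((↑V : Set ℕ) ∪ {M j}) (M '' Ici (j + 1)) := by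
      refine disjoint_left.2 fun i hi hi' => ?_
      have h1 : next (M j) ≤ i := hgt hi'
      have h2 := hlt (M j)
      rcases hi with hi | hi
      · have := hVlt i hi; omega
      · rw [mem_singleton_iff.1 hi] at h1; omega
    have hI : Integrable (fun ω => x (M j) ω * G ω) P :=
      integrable_mul_of_abs_le_one (hxi _) hGm hG1
    have hUu : ∀ T T', U (T ∪ T') = U T ∪ U T' := fun T T' => biUnion_union T T' S
    have hUs : U {M j} = S (M j) := biUnion_singleton _ _
    rw [hsplit, hUu, setIntegral_union (hUu _ _ ▸ hUd hd2) (hUm _) hI.integrableOn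
      hI.integrableOn, hUu, setIntegral_union (hUd hd1) (hUm _) hI.integrableOn hI.integrableOn,
      hUs]
    have e1 : ε ≤ ∫ ω in S (M j), x (M j) ω * G ω ∂P := by
      rw [setIntegral_congr_fun (hS _) (hGS (M j))]
      exact hcon (M j)
    have e2 : |∫ ω in U (M '' Ici (j + 1)), x (M j) ω * G ω ∂P| ≤ ε / 8 :=
      (abs_setIntegral_mul_le (hxi _) hG1 (hUmono hgt)).trans (htail (M j))
    have e3 : |∫ ω in U V, f ω * G ω ∂P| ≤ ε / 8 := by
      refine (abs_setIntegral_mul_le hf hG1 (hUmono ?_)).trans hN₀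
      intro i hi
      obtain ⟨t, ht, rfl⟩ := Finset.mem_image.1 hi
      exact hMmono.monotone (Nat.zero_le t)
    have e4 : |∫ ω in U V, x (M j) ω * G ω ∂P - ∫ ω in U V, f ω * G ω ∂P| ≤ ε / 8 := by
      cases j with
      | zero => simp [hV, hU]; positivity
      | succ i =>
        rw [hMs]
        refine hfin (M i) V (Finset.mem_powerset.2 fun t ht => ?_)
        obtain ⟨r, hr, rfl⟩ := Finset.mem_image.1 ht
        have := hMmono.monotone (Nat.lt_succ_iff.1 (Finset.mem_Ico.1 hr).2)
        exact Finset.mem_range.2 (Nat.lt_succ_of_le this)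
    rw [abs_le] at e2 e3 e4
    linarith [e2.1, e3.1, e4.1]
  obtain ⟨f', hf', hlimf'⟩ := hlim (fun j => x (M j)) fun j => hx _
  obtain ⟨N, hN⟩ := ((tendsto_setIntegral_tail_of_disjoint hf' hS hd).eventually_lt_const
    (by positivity : 0 < ε / 2)).exists
  have h1 : ε / 2 ≤ ∫ ω in U (M '' Ici N), f' ω * G ω ∂P :=
    ge_of_tendsto (hlimf' _) (Nat.hyperfilter_le_atTop
      (eventually_atTop.2 ⟨N, fun j hj => hlow N j hj⟩))
  have h2 : |∫ ω in U (M '' Ici N), f' ω * G ω ∂P| ≤ ∫ ω in U (Ici N), |f' ω| ∂P := by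
    refine abs_setIntegral_mul_le hf' hG1 (hUmono ?_)
    rintro _ ⟨t, ht, rfl⟩
    exact le_trans ht (hMmono.le_apply)
  linarith [le_abs_self (∫ ω in U (M '' Ici N), f' ω * G ω ∂P)]

lemma HasWeakUltralimits.exists_setIntegral_abs_le [IsProbabilityMeasure P] {B : Set (Ω → ℝ)}
    (hW : HasWeakUltralimits P B) (hBm : ∀ f ∈ B, Measurable f) (hB : ∀ f ∈ B, Integrable f P)
    {ε : ℝ} (hε : 0 < ε) :
    ∃ δ > 0, ∀ S, MeasurableSet S → P.real S ≤ δ → ∀ f ∈ B, ∫ ω in S, |f ω| ∂P ≤ ε := by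
  by_contra! hcon
  choose S hSm hSP x hxB hxS using fun k : ℕ => hcon ((1 / 2) ^ k) (by positivity)
  set U : ℕ → Set Ω := fun N => ⋃ m, S (m + N) with hU
  have hUm : ∀ N, MeasurableSet (U N) := fun N => MeasurableSet.iUnion fun m => hSm _
  have hUP : Tendsto (P ∘ U) atTop (𝓝 0) := by
    have hsum : ∑' k, P (S k) ≠ ⊤ := by
      refine ne_top_of_le_ne_top (b := ∑' k : ℕ, (ENNReal.ofReal (1 / 2)) ^ k) ?_
        (ENNReal.tsum_le_tsum fun k => ?_)
      · rw [ENNReal.tsum_geometric]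
        refine ENNReal.inv_ne_top.2 (tsub_pos_iff_lt.2 ?_).ne'
        rw [← ENNReal.ofReal_one]
        exact (ENNReal.ofReal_lt_ofReal_iff one_pos).2 (by norm_num)
      · rw [← ENNReal.ofReal_pow (by norm_num), ← ofReal_measureReal]
        exact ENNReal.ofReal_le_ofReal (hSP k)
    exact tendsto_of_tendsto_of_tendsto_of_le_of_le tendsto_const_nhds
      (ENNReal.tendsto_sum_nat_add _ hsum) (fun _ => zero_le) fun N => measure_iUnion_le _
  have hnext : ∀ k : ℕ, ∃ N, k < N ∧ ∫ ω in U N, |x k ω| ∂P ≤ ε / 2 := fun k =>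
    ((eventually_gt_atTop k).and (((hB _ (hxB k)).abs.tendsto_setIntegral_nhds_zero
      hUP).eventually_le_const (half_pos hε))).exists
  choose next hlt hnext using hnext
  set M : ℕ → ℕ := fun j => next^[j] 0 with hM
  have hMs : ∀ j, M (j + 1) = next (M j) := fun j => Function.iterate_succ_apply' next j 0
  have hMmono : StrictMono M := strictMono_nat_of_lt_succ fun j => by rw [hMs]; exact hlt _
  have hsub : ∀ i j, i < j → S (M j) ⊆ U (M (i + 1)) := fun i j hij => by
    have h1 : M (i + 1) ≤ M j := hMmono.monotone hij
    have h2 := subset_iUnion (fun m => S (m + M (i + 1))) (M j - M (i + 1))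
    rwa [Nat.sub_add_cancel h1] at h2
  obtain ⟨k, hk⟩ := hW.exists_setIntegral_abs_lt_of_disjoint hBm hB (half_pos hε)
    (x := fun k => x (M k)) (S := fun k => S (M k) \ U (M (k + 1))) (fun k => hxB _)
    (fun k => (hSm _).diff (hUm _)) (by
      have aux : ∀ i j, i < j →
          Disjoint (S (M i) \ U (M (i + 1))) (S (M j) \ U (M (j + 1))) := fun i j hij =>
        disjoint_left.2 fun ω h1 h2 => h1.2 (hsub i j hij h2.1)
      intro i j hij
      rcases hij.lt_or_gt with h | h
      · exact aux i j h
      · exact (aux j i h).symm)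
  have hI := (hB _ (hxB (M k))).abs
  have h1 := integral_inter_add_sdiff (hUm (M (k + 1))) (hI.integrableOn (s := S (M k)))
  have h2 : ∫ ω in S (M k) ∩ U (M (k + 1)), |x (M k) ω| ∂P ≤ ε / 2 :=
    (setIntegral_mono_set hI.integrableOn (ae_of_all _ fun _ => abs_nonneg _)
      inter_subset_right.eventuallyLE).trans (hMs k ▸ hnext (M k))
  linarith [hxS (M k)]

/-- The nontrivial half of the Dunford–Pettis criterion. -/
lemma HasWeakUltralimits.unifInt [IsProbabilityMeasure P] {B : Set (Ω → ℝ)}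
    (hW : HasWeakUltralimits P B) (hBm : ∀ f ∈ B, Measurable f) (hB : ∀ f ∈ B, Integrable f P) :
    UnifInt P B :=
  unifInt_of_forall_setIntegral_abs_le hBm hB (hW.exists_integral_abs_le hBm hB)
    fun _ hε => hW.exists_setIntegral_abs_le hBm hB hε

end DunfordPettis

section WeakLimits

variable {Ω : Type*} [MeasurableSpace Ω] {P : Measure Ω} {A : Set (Ω → ℝ)} {l : Filter (Ω → ℝ)}

lemma setIntegral_iUnion_sdiff_biUnion_finset {f : Ω → ℝ} (hf : Integrable f P) {S : ℕ → Set Ω}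
    (hS : ∀ i, MeasurableSet (S i)) (hd : Pairwise (Function.onFun Disjoint S)) (s : Finset ℕ) :
    ∫ ω in (⋃ i, S i) \ ⋃ i ∈ s, S i, f ω ∂P =
      ∫ ω in ⋃ i, S i, f ω ∂P - ∑ i ∈ s, ∫ ω in S i, f ω ∂P := by
  have hsub : ⋃ i ∈ s, S i ⊆ ⋃ i, S i := iUnion₂_subset fun i _ => subset_iUnion S i
  rw [setIntegral_sdiff (s.measurableSet_biUnion fun i _ => hS i) hf.integrableOn hsub,
    integral_biUnion_finset s (fun i _ => hS i) (fun i _ j _ hij => hd hij)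
      fun i _ => hf.integrableOn]

/-- A setwise limit of a uniformly integrable family is given by a density. -/
lemma UnifInt.exists_density [IsProbabilityMeasure P] (hUI : UnifInt P A)
    (hAm : ∀ η ∈ A, Measurable η) (hAi : ∀ η ∈ A, Integrable η P) [l.NeBot]
    (hl : ∀ᶠ η in l, η ∈ A) {L : Set Ω → ℝ}
    (hL : ∀ S, MeasurableSet S → Tendsto (fun η : Ω → ℝ => ∫ ω in S, η ω ∂P) l (𝓝 (L S))) :
    ∃ f : Ω → ℝ, Measurable f ∧ Integrable f P ∧
      ∀ S, MeasurableSet S → L S = ∫ ω in S, f ω ∂P := by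
  classical
  have hsmall : ∀ ε > 0, ∃ δ > 0, ∀ S, MeasurableSet S → P.real S ≤ δ → |L S| ≤ ε := by
    intro ε hε
    obtain ⟨δ, hδ, h⟩ := hUI.exists_setIntegral_abs_le hAm hAi hε
    refine ⟨δ, hδ, fun S hS hPS => le_of_tendsto (hL S hS).abs ?_⟩
    filter_upwards [hl] with η hη
    exact (abs_integral_le_integral_abs).trans (h S hS hPS η hη)
  have hnull : ∀ S, MeasurableSet S → P.real S = 0 → L S = 0 := fun S hS hPS => by
    refine abs_nonpos_iff.1 (le_of_forall_pos_le_add fun ε hε => ?_)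
    obtain ⟨δ, hδ, h⟩ := hsmall ε hε
    rw [zero_add]
    exact h S hS (hPS.le.trans hδ.le)
  let ν : SignedMeasure Ω :=
    { measureOf' := fun S => if MeasurableSet S then L S else 0
      empty' := by
        rw [if_pos MeasurableSet.empty]
        exact hnull ∅ MeasurableSet.empty measureReal_empty
      not_measurable' := fun S hS => if_neg hS
      m_iUnion' := fun S hS hd => by
        simp only [hS, MeasurableSet.iUnion hS, if_true]
        refine Metric.tendsto_nhds.2 fun ε hε => ?_
        obtain ⟨δ, hδ, hδL⟩ := hsmall (ε / 2) (half_pos hε)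
        have hP : HasSum (fun i => P.real (S i)) (P.real (⋃ i, S i)) := by
          have := P.toSignedMeasure.m_iUnion hS hd
          simpa only [Measure.toSignedMeasure_apply_measurable, hS, MeasurableSet.iUnion hS]
            using this
        filter_upwards [Metric.tendsto_nhds.1 hP δ hδ] with s hs
        have hVm : MeasurableSet ((⋃ i, S i) \ ⋃ i ∈ s, S i) :=
          (MeasurableSet.iUnion hS).diff (s.measurableSet_biUnion fun i _ => hS i)
        have hPV := setIntegral_iUnion_sdiff_biUnion_finset (integrable_const (1 : ℝ) (μ := P))
          hS hd s
        simp only [setIntegral_const, smul_eq_mul, mul_one] at hPV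
        have hLV : L ((⋃ i, S i) \ ⋃ i ∈ s, S i) = L (⋃ i, S i) - ∑ i ∈ s, L (S i) := by
          refine tendsto_nhds_unique (hL _ hVm) (((hL _ (MeasurableSet.iUnion hS)).sub
            (tendsto_finsetSum s fun i _ => hL _ (hS i))).congr' ?_)
          filter_upwards [hl] with η hη
          exact (setIntegral_iUnion_sdiff_biUnion_finset (hAi η hη) hS hd s).symm
        rw [dist_comm, Real.dist_eq] at hs ⊢
        rw [← hLV]
        refine (hδL _ hVm ?_).trans_lt (half_lt_self hε)
        rw [hPV]
        exact (le_abs_self _).trans hs.le }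
  have hν : ∀ S, MeasurableSet S → ν S = L S := fun S hS => if_pos hS
  have hac : ν ≪ᵥ P.toENNRealVectorMeasure := by
    refine VectorMeasure.AbsolutelyContinuous.mk fun S hS h0 => ?_
    rw [Measure.toENNRealVectorMeasure_apply_measurable hS] at h0
    rw [hν S hS]
    exact hnull S hS (by rw [measureReal_def, h0, ENNReal.toReal_zero])
  refine ⟨ν.rnDeriv P, SignedMeasure.measurable_rnDeriv ν P, SignedMeasure.integrable_rnDeriv ν P,
    fun S hS => ?_⟩
  rw [← withDensityᵥ_apply (SignedMeasure.integrable_rnDeriv ν P) hS,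
    SignedMeasure.withDensityᵥ_rnDeriv_eq ν P hac, hν S hS]

lemma exists_simpleFunc_abs_sub_le {g : Ω → ℝ} (hg : Measurable g) {C : ℝ}
    (hC : ∀ ω, |g ω| ≤ C) {ε : ℝ} (hε : 0 < ε) :
    ∃ s : SimpleFunc Ω ℝ, ∀ ω, |g ω - s ω| ≤ ε := by
  have hm : Measurable fun ω => ⌊g ω / ε⌋ := Int.measurable_floor.comp (hg.div_const ε)
  refine ⟨⟨fun ω => ε * ⌊g ω / ε⌋, fun x => ?_, ?_⟩, fun ω => ?_⟩
  · have : Measurable fun ω => ε * (⌊g ω / ε⌋ : ℝ) :=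
      measurable_const.mul ((measurable_from_top (f := fun n : ℤ => (n : ℝ))).comp hm)
    exact this (measurableSet_singleton x)
  · refine ((finite_Icc ⌊-C / ε⌋ ⌊C / ε⌋).image fun n : ℤ => ε * (n : ℝ)).subset ?_
    rintro _ ⟨ω, rfl⟩
    have := abs_le.1 (hC ω)
    exact ⟨⌊g ω / ε⌋, ⟨Int.floor_le_floor (by gcongr; exact this.1),
      Int.floor_le_floor (by gcongr; exact this.2)⟩, rfl⟩
  · have h1 := Int.floor_le (g ω / ε)
    have h2 := Int.lt_floor_add_one (g ω / ε)
    rw [le_div_iff₀ hε] at h1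
    rw [div_lt_iff₀ hε] at h2
    change |g ω - ε * ⌊g ω / ε⌋| ≤ ε
    rw [abs_le]
    constructor <;> linarith

lemma abs_integral_mul_sub_le {f g h : Ω → ℝ} (hf : Integrable f P)
    (hfg : Integrable (fun ω => f ω * g ω) P) (hfh : Integrable (fun ω => f ω * h ω) P) {ε : ℝ}
    (hgh : ∀ ω, |g ω - h ω| ≤ ε) :
    |∫ ω, f ω * g ω ∂P - ∫ ω, f ω * h ω ∂P| ≤ ε * ∫ ω, |f ω| ∂P := by
  rw [← integral_sub hfg hfh, ← integral_const_mul, ← Real.norm_eq_abs]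
  refine norm_integral_le_of_norm_le (hf.abs.const_mul ε) (ae_of_all _ fun ω => ?_)
  rw [← mul_sub, norm_mul, mul_comm, Real.norm_eq_abs, Real.norm_eq_abs]
  exact mul_le_mul_of_nonneg_right (hgh ω) (abs_nonneg _)

/-- Setwise convergence of an `L¹`-bounded family upgrades to convergence against bounded
functions. -/
lemma tendsto_integral_mul_of_tendsto_setIntegral [IsFiniteMeasure P] {C : ℝ}
    (hC : ∀ η ∈ A, ∫ ω, |η ω| ∂P ≤ C) (hAi : ∀ η ∈ A, Integrable η P)
    (hl : ∀ᶠ η in l, η ∈ A) {f : Ω → ℝ} (hf : Integrable f P)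
    (hlim : ∀ S, MeasurableSet S →
      Tendsto (fun η : Ω → ℝ => ∫ ω in S, η ω ∂P) l (𝓝 (∫ ω in S, f ω ∂P)))
    {g : Ω → ℝ} (hg : Measurable g) {R : ℝ} (hR : ∀ ω, |g ω| ≤ R) :
    Tendsto (fun η : Ω → ℝ => ∫ ω, η ω * g ω ∂P) l (𝓝 (∫ ω, f ω * g ω ∂P)) := by
  have hmul : ∀ {u : Ω → ℝ} (s : SimpleFunc Ω ℝ), Integrable u P →
      Integrable (fun ω => u ω * s ω) P := fun s hu => by
    obtain ⟨c, hc⟩ := s.exists_forall_norm_le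
    exact hu.mul_bdd s.measurable.aestronglyMeasurable (ae_of_all _ hc)
  have hsimple : ∀ s : SimpleFunc Ω ℝ,
      Tendsto (fun η : Ω → ℝ => ∫ ω, η ω * s ω ∂P) l (𝓝 (∫ ω, f ω * s ω ∂P)) := by
    intro s
    induction s using SimpleFunc.induction with
    | const c hS =>
      rename_i S
      have key : ∀ u : Ω → ℝ, ∫ ω, u ω * (SimpleFunc.piecewise S hS (SimpleFunc.const Ω c)
          (SimpleFunc.const Ω 0)) ω ∂P = (∫ ω in S, u ω ∂P) * c := fun u => by
        rw [← integral_mul_const, ← integral_indicator hS]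
        refine integral_congr_ae (ae_of_all _ fun ω => ?_)
        by_cases hω : ω ∈ S <;> simp [hω]
      simp only [key]
      exact (hlim S hS).mul_const c
    | add _ hs ht =>
      rename_i s t _
      have key : ∀ {u : Ω → ℝ}, Integrable u P →
          ∫ ω, u ω * s ω ∂P + ∫ ω, u ω * t ω ∂P = ∫ ω, u ω * (s + t) ω ∂P := fun hu => by
        rw [← integral_add (hmul s hu) (hmul t hu)]
        simp only [SimpleFunc.coe_add, Pi.add_apply, mul_add]
      rw [← key hf]
      refine (hs.add ht).congr' ?_
      filter_upwards [hl] with η hη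
      exact key (hAi η hη)
  refine Metric.tendsto_nhds.2 fun ε hε => ?_
  set D : ℝ := |C| + ∫ ω, |f ω| ∂P + 1 with hD
  have hf0 : 0 ≤ ∫ ω, |f ω| ∂P := integral_nonneg fun _ => abs_nonneg _
  have hD0 : 0 < D := by positivity
  obtain ⟨s, hs⟩ := exists_simpleFunc_abs_sub_le hg hR (ε := ε / (2 * D)) (by positivity)
  have hgi : ∀ {u : Ω → ℝ}, Integrable u P → Integrable (fun ω => u ω * g ω) P := fun hu =>
    hu.mul_bdd hg.aestronglyMeasurable (ae_of_all _ hR)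
  filter_upwards [hl, Metric.tendsto_nhds.1 (hsimple s) (ε / 2) (by positivity)] with η hη hηs
  have h1 := abs_integral_mul_sub_le (hAi η hη) (hgi (hAi η hη)) (hmul s (hAi η hη)) hs
  have h2 := abs_integral_mul_sub_le hf (hgi hf) (hmul s hf) hs
  have h3 : ε / (2 * D) * ∫ ω, |η ω| ∂P + ε / (2 * D) * ∫ ω, |f ω| ∂P ≤ ε / 2 := by
    rw [← mul_add]
    calc ε / (2 * D) * (∫ ω, |η ω| ∂P + ∫ ω, |f ω| ∂P) ≤ ε / (2 * D) * D := by
          gcongr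
          linarith [hC η hη, le_abs_self C]
      _ = ε / 2 := by field_simp
  rw [Real.dist_eq] at hηs ⊢
  rw [abs_le] at h1 h2
  rw [abs_lt] at hηs ⊢
  constructor <;> linarith [h1.1, h1.2, h2.1, h2.2, hηs.1, hηs.2]

lemma aecover_abs_le {ξ : Ω → ℝ} (hξ : Measurable ξ) :
    AECover P atTop fun N : ℕ => {ω | |ξ ω| ≤ N} where
  ae_eventually_mem := ae_of_all _ fun ω =>
    tendsto_natCast_atTop_atTop.eventually_ge_atTop |ξ ω|
  measurableSet _ := measurableSet_le hξ.norm measurable_const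

/-- Convergence against bounded functions extends to any `ξ` for which the products `η ξ` are
uniformly integrable. -/
lemma UnifInt.tendsto_integral_mul [IsProbabilityMeasure P] {ξ : Ω → ℝ} (hξ : Measurable ξ)
    (hAm : ∀ η ∈ A, Measurable η) (hAξ : ∀ η ∈ A, Integrable (fun ω => η ω * ξ ω) P)
    (hUI : UnifInt P {g : Ω → ℝ | ∃ η ∈ A, g = fun ω => η ω * ξ ω}) [l.NeBot]
    (hl : ∀ᶠ η in l, η ∈ A) {f : Ω → ℝ} (hfm : Measurable f) (hf : Integrable f P)
    (hlim : ∀ (g : Ω → ℝ) (R : ℝ), Measurable g → (∀ ω, |g ω| ≤ R) →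
      Tendsto (fun η : Ω → ℝ => ∫ ω, η ω * g ω ∂P) l (𝓝 (∫ ω, f ω * g ω ∂P))) :
    Integrable (fun ω => f ω * ξ ω) P ∧
      Tendsto (fun η : Ω → ℝ => ∫ ω, η ω * ξ ω ∂P) l (𝓝 (∫ ω, f ω * ξ ω ∂P)) := by
  set φ : ℕ → Set Ω := fun N => {ω | |ξ ω| ≤ N} with hφ
  have hcov : AECover P atTop φ := aecover_abs_le hξ
  have hφm : ∀ N, MeasurableSet (φ N) := hcov.measurableSet
  have hBm : ∀ g ∈ {g : Ω → ℝ | ∃ η ∈ A, g = fun ω => η ω * ξ ω}, Measurable g := by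
    rintro _ ⟨η, hη, rfl⟩
    exact (hAm η hη).mul hξ
  have hBi : ∀ g ∈ {g : Ω → ℝ | ∃ η ∈ A, g = fun ω => η ω * ξ ω}, Integrable g P := by
    rintro _ ⟨η, hη, rfl⟩
    exact hAξ η hη
  have htr : ∀ N ω, |(φ N).indicator ξ ω| ≤ N := fun N ω => by
    by_cases hω : ω ∈ φ N
    · rw [indicator_of_mem hω]; exact hω
    · rw [indicator_of_notMem hω, abs_zero]; exact N.cast_nonneg
  have hset : ∀ N (u : Ω → ℝ),
      ∫ ω, u ω * (φ N).indicator ξ ω ∂P = ∫ ω in φ N, u ω * ξ ω ∂P := fun N u => by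
    simp only [← indicator_mul_right, integral_indicator (hφm N)]
  have h_int : Integrable (fun ω => f ω * ξ ω) P := by
    obtain ⟨C, hC⟩ := hUI.exists_integral_abs_le hBm hBi
    refine hcov.integrable_of_integral_norm_bounded C (fun N => ?_) (Eventually.of_forall fun N => ?_)
    · rw [← integrable_indicator_iff (hφm N)]
      have : (φ N).indicator (fun ω => f ω * ξ ω) = fun ω => f ω * (φ N).indicator ξ ω :=
        funext fun ω => indicator_mul_right _ _ _
      rw [this]
      exact hf.mul_bdd (hξ.indicator (hφm N)).aestronglyMeasurable (ae_of_all _ (htr N))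
    · obtain ⟨s, hsm, hs1, hs⟩ := exists_measurable_sign (hfm.mul hξ)
      have hle : ∀ ω, |(φ N).indicator ξ ω * s ω| ≤ N := fun ω => by
        rw [abs_mul]
        exact (mul_le_of_le_one_right (abs_nonneg _) (hs1 ω)).trans (htr N ω)
      have h1 := hlim (fun ω => (φ N).indicator ξ ω * s ω) N ((hξ.indicator (hφm N)).mul hsm) hle
      have h2 : ∫ ω, f ω * ((φ N).indicator ξ ω * s ω) ∂P = ∫ ω in φ N, ‖f ω * ξ ω‖ ∂P := by
        rw [← integral_indicator (hφm N)]
        refine integral_congr_ae (ae_of_all _ fun ω => ?_)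
        by_cases hω : ω ∈ φ N
        · simp only [indicator_of_mem hω, ← mul_assoc]
          exact hs ω
        · simp only [indicator_of_notMem hω, zero_mul, mul_zero]
      rw [← h2]
      refine le_of_tendsto h1 ?_
      filter_upwards [hl] with η hη
      refine le_trans ?_ (hC _ ⟨η, hη, rfl⟩)
      refine (le_abs_self _).trans ?_
      rw [← Real.norm_eq_abs]
      refine norm_integral_le_of_norm_le (hAξ η hη).abs (ae_of_all _ fun ω => ?_)
      rw [Real.norm_eq_abs, abs_mul, abs_mul, abs_mul]
      refine mul_le_mul_of_nonneg_left ?_ (abs_nonneg _)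
      exact (mul_le_of_le_one_right (abs_nonneg _) (hs1 ω)).trans
        (norm_indicator_le_norm_self ξ ω)
  refine ⟨h_int, Metric.tendsto_nhds.2 fun ε hε => ?_⟩
  obtain ⟨δ, hδ, hδA⟩ := hUI.exists_setIntegral_abs_le hBm hBi (ε := ε / 4) (by positivity)
  have hP : Tendsto (fun N => P.real (φ N)ᶜ) atTop (𝓝 0) := by
    have h := hcov.integral_tendsto_of_countably_generated (integrable_const (1 : ℝ))
    simp only [smul_eq_mul, mul_one, integral_const, measureReal_restrict_apply_univ,
      probReal_univ] at h
    have h' := h.const_sub 1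
    rw [sub_self] at h'
    refine h'.congr fun N => ?_
    rw [measureReal_compl (hφm N), probReal_univ]
  obtain ⟨N, hN, hNf⟩ := ((hP.eventually_le_const hδ).and
    (Metric.tendsto_nhds.1 (hcov.integral_tendsto_of_countably_generated h_int) (ε / 4)
      (by positivity))).exists
  have hb := hlim _ N (hξ.indicator (hφm N)) (htr N)
  simp only [hset] at hb
  filter_upwards [hl, Metric.tendsto_nhds.1 hb (ε / 4) (by positivity)] with η hη hηN
  have h1 : |∫ ω in (φ N)ᶜ, η ω * ξ ω ∂P| ≤ ε / 4 :=
    (abs_integral_le_integral_abs).trans (hδA _ (hφm N).compl hN _ ⟨η, hη, rfl⟩)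
  have h2 := integral_add_compl (hφm N) (hAξ η hη)
  rw [Real.dist_eq] at hηN hNf ⊢
  rw [abs_le] at h1
  rw [abs_lt] at hηN hNf ⊢
  constructor <;> linarith [h1.1, h1.2, hηN.1, hηN.2, hNf.1, hNf.2]

end WeakLimits

section WeakCompactness

variable {Ω : Type*} [MeasurableSpace Ω] {P : Measure Ω} [IsProbabilityMeasure P] {Φ : ℝ → ℝ}
  {A : Set (Ω → ℝ)}

lemma IsYoung.unifInt_mul_of_isCompact_closure (hΦ : IsYoung Φ) (hA : A ⊆ Orlicz P Φ)
    (hK : @IsCompact _ (weakT P (Orlicz P Φ) (Orlicz P (conj Φ)))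
      (@closure _ (weakT P (Orlicz P Φ) (Orlicz P (conj Φ))) {η : Orlicz P Φ | ↑η ∈ A}))
    {ξ : Ω → ℝ} (hξ : MemOrlicz P (conj Φ) ξ) :
    UnifInt P {g : Ω → ℝ | ∃ η ∈ A, g = fun ω => η ω * ξ ω} := by
  let : TopologicalSpace (Orlicz P Φ) := weakT P (Orlicz P Φ) (Orlicz P (conj Φ))
  have hind : IsInducing fun (η : Orlicz P Φ) (ζ : Orlicz P (conj Φ)) => pairing P η ζ := ⟨rfl⟩
  refine HasWeakUltralimits.unifInt (fun x hx => ?_) ?_ ?_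
  · choose y hyA hy using hx
    set z : ℕ → Orlicz P Φ := fun k => ⟨y k, hA (hyA k)⟩ with hz
    obtain ⟨η, -, hη⟩ := hK.ultrafilter_le_nhds ((hyperfilter ℕ).map z)
      (le_principal_iff.2 (Filter.mem_map.2 (Eventually.of_forall fun k =>
        subset_closure (hyA k))))
    have hlim : ∀ ζ : Orlicz P (conj Φ),
        Tendsto (fun k => pairing P (y k) ζ) (hyperfilter ℕ) (𝓝 (pairing P η ζ)) :=
      tendsto_pi_nhds.1 (hind.tendsto_nhds_iff.1 (show Tendsto z (hyperfilter ℕ) (𝓝 η) from hη))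
    refine ⟨fun ω => (η : Ω → ℝ) ω * ξ ω, hΦ.integrable_mul η.2 hξ, fun h hh hh1 => ?_⟩
    have hmem : MemOrlicz P (conj Φ) fun ω => ξ ω * h ω :=
      hΦ.memOrlicz_conj_of_abs_le hξ (hξ.1.mul hh) fun ω => by
        rw [abs_mul]
        exact mul_le_of_le_one_right (abs_nonneg _) (hh1 ω)
    simpa only [hy, pairing, mul_assoc] using hlim ⟨_, hmem⟩
  · rintro _ ⟨η, hη, rfl⟩
    exact (hA hη).1.mul hξ.1
  · rintro _ ⟨η, hη, rfl⟩
    exact hΦ.integrable_mul (hA hη) hξ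

lemma IsYoung.exists_pairing_eq_of_mem_closure (hΦ : IsYoung Φ) (hA : A ⊆ Orlicz P Φ)
    (hUI : ∀ ξ ∈ Orlicz P (conj Φ), UnifInt P {g : Ω → ℝ | ∃ η ∈ A, g = fun ω => η ω * ξ ω})
    {L : Orlicz P (conj Φ) → ℝ}
    (hL : L ∈ closure ((fun (η : Ω → ℝ) (ζ : Orlicz P (conj Φ)) => pairing P η ζ) '' A)) :
    ∃ f ∈ Orlicz P Φ, ∀ ζ : Orlicz P (conj Φ), L ζ = pairing P f ζ := by
  classical
  set T : (Ω → ℝ) → Orlicz P (conj Φ) → ℝ := fun η ζ => pairing P η ζ with hT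
  set l : Filter (Ω → ℝ) := comap T (𝓝 L) ⊓ 𝓟 A with hl
  have : l.NeBot := by
    rw [mem_closure_iff_clusterPt, ClusterPt, ← map_principal, ← Filter.push_pull'] at hL
    exact hL.of_map
  have hlA : ∀ᶠ η in l, η ∈ A := mem_inf_of_right (mem_principal_self A)
  have hlim : ∀ ζ : Orlicz P (conj Φ), Tendsto (fun η => pairing P η ζ) l (𝓝 (L ζ)) :=
    tendsto_pi_nhds.1 (tendsto_comap.mono_left inf_le_left)
  have hone : MemOrlicz P (conj Φ) fun _ : Ω => (1 : ℝ) := memOrlicz_const _ _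
  have hAm : ∀ η ∈ A, Measurable η := fun η hη => (hA hη).1
  have hAi : ∀ η ∈ A, Integrable η P := fun η hη => by
    simpa only [mul_one] using hΦ.integrable_mul (hA hη) hone
  have hUA : UnifInt P A := by
    have h := hUI _ hone
    simp only [mul_one] at h
    convert! h using 1
    ext g
    exact ⟨fun h => ⟨g, h, rfl⟩, fun ⟨η, hη, h⟩ => h ▸ hη⟩
  have hind : ∀ S, MeasurableSet S → MemOrlicz P (conj Φ) (S.indicator fun _ => (1 : ℝ)) :=
    fun S hS => hΦ.memOrlicz_conj_of_abs_le hone (measurable_const.indicator hS)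
      fun ω => norm_indicator_le_norm_self (fun _ => (1 : ℝ)) ω
  have hset : ∀ S, MeasurableSet S → ∀ η : Ω → ℝ,
      pairing P η (S.indicator fun _ => (1 : ℝ)) = ∫ ω in S, η ω ∂P := fun S hS η => by
    rw [pairing, ← integral_indicator hS]
    refine integral_congr_ae (ae_of_all _ fun ω => ?_)
    by_cases hω : ω ∈ S <;> simp [hω]
  obtain ⟨f, hfm, hfi, hf⟩ := hUA.exists_density hAm hAi hlA
    (L := fun S => if hS : MeasurableSet S then L ⟨_, hind S hS⟩ else 0) fun S hS => by
      rw [dif_pos hS]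
      exact (hlim ⟨_, hind S hS⟩).congr (hset S hS)
  obtain ⟨C, hC⟩ := hUA.exists_integral_abs_le hAm hAi
  have hsets : ∀ S, MeasurableSet S →
      Tendsto (fun η : Ω → ℝ => ∫ ω in S, η ω ∂P) l (𝓝 (∫ ω in S, f ω ∂P)) := fun S hS => by
    rw [← hf S hS, dif_pos hS]
    exact (hlim ⟨_, hind S hS⟩).congr (hset S hS)
  have key : ∀ ξ, MemOrlicz P (conj Φ) ξ → Integrable (fun ω => f ω * ξ ω) P ∧
      Tendsto (fun η : Ω → ℝ => ∫ ω, η ω * ξ ω ∂P) l (𝓝 (∫ ω, f ω * ξ ω ∂P)) := fun ξ hξ =>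
    (hUI ξ hξ).tendsto_integral_mul hξ.1 hAm (fun η hη => hΦ.integrable_mul (hA hη) hξ) hlA
      hfm hfi fun g R hg hR =>
        tendsto_integral_mul_of_tendsto_setIntegral hC hAi hlA hfi hsets hg hR
  exact ⟨f, hΦ.memOrlicz_of_forall_integrable hfm fun ξ hξ => (key ξ hξ).1,
    fun ζ => tendsto_nhds_unique (hlim ζ) (key ζ ζ.2).2⟩

lemma IsYoung.isCompact_closure_of_unifInt_mul (hΦ : IsYoung Φ) (hA : A ⊆ Orlicz P Φ)
    (hUI : ∀ ξ ∈ Orlicz P (conj Φ), UnifInt P {g : Ω → ℝ | ∃ η ∈ A, g = fun ω => η ω * ξ ω}) :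
    @IsCompact _ (weakT P (Orlicz P Φ) (Orlicz P (conj Φ)))
      (@closure _ (weakT P (Orlicz P Φ) (Orlicz P (conj Φ))) {η : Orlicz P Φ | ↑η ∈ A}) := by
  let : TopologicalSpace (Orlicz P Φ) := weakT P (Orlicz P Φ) (Orlicz P (conj Φ))
  set T : Orlicz P Φ → Orlicz P (conj Φ) → ℝ := fun η ζ => pairing P η ζ with hT
  have hind : IsInducing T := ⟨rfl⟩
  have himage : T '' {η : Orlicz P Φ | ↑η ∈ A} =
      (fun (η : Ω → ℝ) (ζ : Orlicz P (conj Φ)) => pairing P η ζ) '' A := by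
    ext L
    constructor
    · rintro ⟨η, hη, rfl⟩
      exact ⟨η, hη, rfl⟩
    · rintro ⟨η, hη, rfl⟩
      exact ⟨⟨η, hA hη⟩, hη, rfl⟩
  have hbound : ∀ ζ : Orlicz P (conj Φ), ∃ C : ℝ, ∀ η ∈ A, |pairing P η ζ| ≤ C := fun ζ => by
    obtain ⟨C, hC⟩ := (hUI ζ ζ.2).exists_integral_abs_le
      (by rintro _ ⟨η, hη, rfl⟩; exact (hA hη).1.mul ζ.2.1)
      (by rintro _ ⟨η, hη, rfl⟩; exact hΦ.integrable_mul (hA hη) ζ.2)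
    exact ⟨C, fun η hη => abs_integral_le_integral_abs.trans (hC _ ⟨η, hη, rfl⟩)⟩
  choose C hC using hbound
  have hcomp : IsCompact (closure (T '' {η : Orlicz P Φ | ↑η ∈ A})) := by
    refine (isCompact_univ_pi fun ζ => isCompact_Icc (a := -C ζ) (b := C ζ)).closure_of_subset ?_
    rintro _ ⟨η, hη, rfl⟩ ζ -
    exact abs_le.1 (hC ζ η hη)
  rw [hind.closure_eq_preimage_closure_image]
  refine hind.isCompact_preimage' hcomp fun L hL => ?_
  rw [himage] at hL
  obtain ⟨f, hf, hLf⟩ := hΦ.exists_pairing_eq_of_mem_closure hA hUI hL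
  exact ⟨⟨f, hf⟩, (funext hLf).symm⟩

end WeakCompactness

/-- (No Δ₂ assumed.) A set `A ⊆ L_Φ` is relatively
`σ(L_Φ, L_{Φ*})`-compact iff for every `ξ ∈ L_{Φ*}` the set
`A ξ = {η ξ : η ∈ A}` is uniformly integrable. -/
theorem statement1
    {Ω : Type*} [MeasurableSpace Ω] (P : Measure Ω) [IsProbabilityMeasure P]
    (Φ : ℝ → ℝ) (hΦ : IsYoung Φ)
    (A : Set (Ω → ℝ)) (hA : A ⊆ Orlicz P Φ) :
    @IsCompact _ (weakT P (Orlicz P Φ) (Orlicz P (conj Φ)))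
      (@closure _ (weakT P (Orlicz P Φ) (Orlicz P (conj Φ)))
        {η : Orlicz P Φ | ↑η ∈ A}) ↔
    ∀ ξ ∈ Orlicz P (conj Φ),
      UnifInt P {g : Ω → ℝ | ∃ η ∈ A, g = fun ω => η ω * ξ ω} :=
  ⟨fun hK _ hξ => hΦ.unifInt_mul_of_isCompact_closure hA hK hξ,
    hΦ.isCompact_closure_of_unifInt_mul hA⟩

end OrliczPaper
end
end
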